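/- arXiv:2009.12803 — 2 statements merged into one kernel-verified Lean document; each statement's English description precedes it below -/
import Mathlib

section
/- Let p, q, p', q' be integers such that 2 ≤ q ≤ min{q', p'} and max{q', p'} < p. If min{q', p'} ≤ 2q−1, then there does not exist any proper holomorphic map from D^I_{p,q} to D^I_{p',q'}. -/
open Matrix
open scoped ComplexOrder

attribute [local instance] Matrix.normedAddCommGroup Matrix.normedSpace

/-- The type-I irreducible bounded symmetric domain `D^I_{m,n}`,
realized as the set of complex `m × n` matrices `Z` with `I - Zᴴ Z` positive definite. -/
def typeIDomain (m n : ℕ) : Set (Matrix (Fin m) (Fin n) ℂ) :=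
  {Z | (1 - Zᴴ * Z).PosDef}

/-- `f` maps `D` into `D'` and the `f`-preimage of every compact subset of `D'`
is a compact subset of `D`. -/
def ProperOn {E F : Type*} [TopologicalSpace E] [TopologicalSpace F]
    (f : E → F) (D : Set E) (D' : Set F) : Prop :=
  Set.MapsTo f D D' ∧ ∀ K : Set F, K ⊆ D' → IsCompact K → IsCompact (D ∩ f ⁻¹' K)

open Filter Topology

namespace TypeI

/-- Identity theorem on open convex sets. -/
lemma ident {E F : Type*} [NormedAddCommGroup E] [NormedSpace ℂ E]
    [NormedAddCommGroup F] [NormedSpace ℂ F] [CompleteSpace F]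
    {U : Set E} (hU : IsOpen U) (hc : Convex ℝ U) {f : E → F}
    (hf : DifferentiableOn ℂ f U) {z0 : E} (hz0 : z0 ∈ U)
    (h : ∀ᶠ z in 𝓝 z0, f z = 0) : ∀ z ∈ U, f z = 0 := by
  intro z hz
  let γ : ℂ → E := fun t => z0 + t • (z - z0)
  have hγ : Differentiable ℂ γ := by fun_prop
  have hT : IsOpen (γ ⁻¹' U) := hU.preimage hγ.continuous
  have hTc : Convex ℝ (γ ⁻¹' U) := by
    intro s hs t ht a b ha hb hab
    have := hc hs ht ha hb hab
    have e : γ (a • s + b • t) = a • γ s + b • γ t := by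
      simp only [γ]
      have h1 : z0 = (a + b) • z0 := by rw [hab, one_smul]
      nth_rewrite 1 [h1]
      simp only [smul_add, add_smul, smul_assoc]
      abel
    show γ (a • s + b • t) ∈ U
    rw [e]; exact this
  have h0 : (0 : ℂ) ∈ γ ⁻¹' U := by simpa [γ] using hz0
  have h1 : (1 : ℂ) ∈ γ ⁻¹' U := by simpa [γ] using hz
  have hd : DifferentiableOn ℂ (f ∘ γ) (γ ⁻¹' U) :=
    hf.comp hγ.differentiableOn (fun _ hx => hx)
  have ha := hd.analyticOnNhd hT
  have he : (f ∘ γ) =ᶠ[𝓝 0] 0 := by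
    have : Tendsto γ (𝓝 0) (𝓝 z0) := by
      have := hγ.continuous.tendsto 0
      simpa [γ] using this
    exact this.eventually h
  have := ha.eqOn_zero_of_preconnected_of_eventuallyEq_zero hTc.isPreconnected h0 he h1
  simpa [γ] using this

section sec
variable {V : Type*} [NormedAddCommGroup V] [NormedSpace ℂ V]

/-- Matrix of values of functionals on vectors. -/
noncomputable def secN {r : ℕ} (e : Fin r → V) (ψ : Fin r → (V →L[ℂ] ℂ)) : Matrix (Fin r) (Fin r) ℂ :=
  Matrix.of fun j k => ψ j (e k)

/-- The section `δ a - ∑ (adj N v)_k e_k`. -/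
noncomputable def secA {r : ℕ} (e : Fin r → V) (a : V) (ψ : Fin r → (V →L[ℂ] ℂ)) : V :=
  (secN e ψ).det • a - ∑ k, ((secN e ψ).adjugate *ᵥ (fun j => ψ j a)) k • e k

/-- Common kernel. -/
noncomputable def kerAll {r : ℕ} (ψ : Fin r → (V →L[ℂ] ℂ)) : Submodule ℂ V :=
  LinearMap.ker (LinearMap.pi fun j => (ψ j : V →ₗ[ℂ] ℂ))

lemma mem_kerAll {r : ℕ} {ψ : Fin r → (V →L[ℂ] ℂ)} {a : V} :
    a ∈ kerAll ψ ↔ ∀ j, ψ j a = 0 := by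
  simp [kerAll, funext_iff]

lemma secA_ker {r : ℕ} (e : Fin r → V) (ψ : Fin r → (V →L[ℂ] ℂ)) (a : V) :
    secA e a ψ ∈ kerAll ψ := by
  rw [mem_kerAll]
  intro j
  have h1 : ∑ k, ((secN e ψ).adjugate *ᵥ (fun j => ψ j a)) k * ψ j (e k)
      = (secN e ψ *ᵥ ((secN e ψ).adjugate *ᵥ (fun j => ψ j a))) j := by
    simp only [Matrix.mulVec, dotProduct, secN, Matrix.of_apply]
    exact Finset.sum_congr rfl fun k _ => mul_comm _ _
  simp only [secA, map_sub, map_smul, map_sum, smul_eq_mul]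
  rw [h1, Matrix.mulVec_mulVec, Matrix.mul_adjugate]
  simp [Matrix.smul_mulVec]

lemma secA_of_ker {r : ℕ} (e : Fin r → V) (ψ : Fin r → (V →L[ℂ] ℂ)) (a : V)
    (h : ∀ j, ψ j a = 0) : secA e a ψ = (secN e ψ).det • a := by
  have : (fun j => ψ j a) = 0 := funext h
  simp [secA, this]

lemma differentiable_det_of {E : Type*} [NormedAddCommGroup E] [NormedSpace ℂ E] {r : ℕ}
    (M : E → Matrix (Fin r) (Fin r) ℂ) (h : ∀ i j, Differentiable ℂ fun x => M x i j) :
    Differentiable ℂ fun x => (M x).det := by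
  simp only [Matrix.det_apply]
  refine Differentiable.fun_sum fun σ _ => ?_
  refine Differentiable.const_smul ?_ _
  intro x
  have := HasFDerivAt.finsetProd (u := Finset.univ) (g := fun i x => M x (σ i) i) (x := x)
    fun i _ => (h _ _ x).hasFDerivAt
  exact this.differentiableAt

lemma differentiable_secN_det {r : ℕ} (e : Fin r → V) :
    Differentiable ℂ fun ψ : Fin r → (V →L[ℂ] ℂ) => (secN e ψ).det := by
  apply differentiable_det_of
  intro i j
  simp only [secN, Matrix.of_apply]
  fun_prop

lemma differentiable_secA {r : ℕ} (e : Fin r → V) (a : V) :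
    Differentiable ℂ (secA e a) := by
  unfold secA
  refine ((differentiable_secN_det e).smul_const a).sub ?_
  refine Differentiable.fun_sum fun k _ => ?_
  refine Differentiable.smul_const ?_ _
  simp only [Matrix.mulVec, dotProduct]
  refine Differentiable.fun_sum fun j _ => ?_
  refine Differentiable.mul ?_ (by fun_prop)
  simp only [Matrix.adjugate_apply]
  apply differentiable_det_of
  intro i l
  by_cases hi : i = j
  · subst hi
    simp
  · simp only [Matrix.updateRow_ne hi, secN, Matrix.of_apply]
    fun_prop

variable [FiniteDimensional ℂ V]

lemma finrank_kerAll {r : ℕ} (e : Fin r → V) (ψ : Fin r → (V →L[ℂ] ℂ))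
    (h : (secN e ψ).det ≠ 0) : Module.finrank ℂ (kerAll ψ) + r = Module.finrank ℂ V := by
  have hs : Function.Surjective (LinearMap.pi fun j => (ψ j : V →ₗ[ℂ] ℂ)) := by
    intro v
    have hu : IsUnit (secN e ψ) := (Matrix.isUnit_iff_isUnit_det _).2 (isUnit_iff_ne_zero.2 h)
    obtain ⟨c, hc⟩ := (Matrix.mulVec_surjective_iff_isUnit.2 hu) v
    refine ⟨∑ k, c k • e k, ?_⟩
    rw [← hc]
    ext j
    simp [Matrix.mulVec, dotProduct, secN, mul_comm]
  have := LinearMap.finrank_range_add_finrank_ker (LinearMap.pi fun j => (ψ j : V →ₗ[ℂ] ℂ))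
  rw [LinearMap.range_eq_top.2 hs] at this
  simp at this
  rw [kerAll]
  omega

lemma secA_mem {r : ℕ} (e : Fin r → V) (ψ ψ1 : Fin r → (V →L[ℂ] ℂ))
    (h : (secN e ψ).det ≠ 0) (h1 : (secN e ψ1).det ≠ 0) (K : Submodule ℂ V)
    (hK : K ≤ kerAll ψ) (hd : Module.finrank ℂ (kerAll ψ1) ≤ Module.finrank ℂ K) (a : V) :
    secA e a ψ ∈ K := by
  have e1 := finrank_kerAll e ψ h
  have e2 := finrank_kerAll e ψ1 h1
  have : K = kerAll ψ := Submodule.eq_of_le_of_finrank_le hK (by omega)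
  rw [this]
  exact secA_ker e ψ a

lemma sec_exists {ι : Type*} (φ : ι → (V →L[ℂ] ℂ)) :
    ∃ (r : ℕ) (i : Fin r → ι) (e : Fin r → V), (secN e fun j => φ (i j)) = 1 ∧
      ∀ a, a ∈ kerAll (fun j => φ (i j)) ↔ ∀ k, φ k a = 0 := by
  obtain ⟨b, hb, hspan, hli⟩ := exists_linearIndependent ℂ (Set.range φ)
  have hfin : b.Finite := hli.setFinite
  have := hfin.fintype
  let eq := Fintype.equivFin b
  have hx : ∀ j : Fin (Fintype.card b), ∃ i, φ i = (eq.symm j : V →L[ℂ] ℂ) :=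
    fun j => hb (eq.symm j).2
  choose i hi using hx
  have hli2 : LinearIndependent ℂ (fun j => φ (i j)) := by
    have h1 : (fun j => φ (i j)) = Subtype.val ∘ eq.symm := funext hi
    rw [h1]
    exact hli.comp eq.symm eq.symm.injective
  have hs : Function.Surjective (LinearMap.pi fun j => (φ (i j) : V →ₗ[ℂ] ℂ)) := by
    rw [← LinearMap.range_eq_top]
    by_contra hne
    obtain ⟨f, hf, hle⟩ := Submodule.exists_le_ker_of_lt_top _ (lt_top_iff_ne_top.2 hne)
    apply hf
    have key : ∀ j, f (Pi.single j 1) = 0 := by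
      refine Fintype.linearIndependent_iff.1 hli2 (fun j => f (Pi.single j 1)) ?_
      ext v
      have := hle (LinearMap.mem_range_self _ v)
      rw [LinearMap.mem_ker, LinearMap.pi_apply_eq_sum_univ] at this
      have e1 : ∀ k : Fin (Fintype.card b), (fun j => if k = j then (1:ℂ) else 0) = Pi.single k 1 := by
        intro k; ext j; simp [Pi.single_apply, eq_comm]
      simpa [mul_comm, e1] using this
    ext j
    simpa using key j
  choose e he using fun k => hs (Pi.single k 1)
  refine ⟨_, i, e, ?_, ?_⟩
  · ext j k
    have := congrFun (he k) j
    simp only [LinearMap.pi_apply] at this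
    simp only [secN, Matrix.of_apply]
    rw [Matrix.one_apply]
    simpa [Pi.single_apply] using this
  · intro a
    rw [mem_kerAll]
    refine ⟨fun h k => ?_, fun h j => h _⟩
    have hk : φ k ∈ Submodule.span ℂ b := by
      rw [hspan]; exact Submodule.subset_span ⟨k, rfl⟩
    have hle : Submodule.span ℂ b ≤ LinearMap.ker ((ContinuousLinearMap.apply ℂ ℂ a : (V →L[ℂ] ℂ) →L[ℂ] ℂ) : (V →L[ℂ] ℂ) →ₗ[ℂ] ℂ) := by
      rw [Submodule.span_le]
      intro x hx
      have := h (eq ⟨x, hx⟩)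
      rw [hi] at this
      simpa using this
    simpa using hle hk

end sec

end TypeI

open Filter Topology

namespace TypeI

lemma clm_comp_diff {E A B : Type*} [NormedAddCommGroup E] [NormedSpace ℂ E]
    [NormedAddCommGroup A] [NormedSpace ℂ A] [NormedAddCommGroup B] [NormedSpace ℂ B]
    (T : A →L[ℂ] B) {g : E → A} {s : Set E} (h : DifferentiableOn ℂ g s) :
    DifferentiableOn ℂ (fun z => T (g z)) s := by
  fun_prop

section D2
variable {X : Type*} [NormedAddCommGroup X] [InnerProductSpace ℂ X]

/-- The domain of pairs of vectors (columns), i.e. type-I domain with two columns. -/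
def D2 (X : Type*) [NormedAddCommGroup X] [InnerProductSpace ℂ X] : Set (X × X) :=
  {z | ∀ α β : ℂ, (α ≠ 0 ∨ β ≠ 0) → ‖α • z.1 + β • z.2‖ ^ 2 < ‖α‖ ^ 2 + ‖β‖ ^ 2}

lemma norm_comb_sq (x y : X) (α β : ℂ) : ‖α • x + β • y‖ ^ 2 =
    ‖α‖ ^ 2 * ‖x‖ ^ 2 + ‖β‖ ^ 2 * ‖y‖ ^ 2 + 2 * ((starRingEnd ℂ) α * β * inner ℂ x y).re := by
  rw [@norm_add_sq ℂ]
  simp only [norm_smul, mul_pow, inner_smul_left, inner_smul_right, RCLike.re_eq_complex_re]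
  ring_nf

lemma mem_D2_iff (x y : X) : (x, y) ∈ D2 X ↔
    ‖x‖ ^ 2 < 1 ∧ ‖(inner ℂ x y : ℂ)‖ ^ 2 < (1 - ‖x‖ ^ 2) * (1 - ‖y‖ ^ 2) := by
  set s : ℂ := inner ℂ x y with hs
  have hns : ‖s‖ ^ 2 = s.re ^ 2 + s.im ^ 2 := by rw [← Complex.normSq_eq_norm_sq, Complex.normSq_apply]; ring
  constructor
  · intro h
    have h1 : ‖x‖ ^ 2 < 1 := by simpa using h 1 0 (by simp)
    refine ⟨h1, ?_⟩
    have hA : 0 < 1 - ‖x‖ ^ 2 := by linarith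
    have h2 := h s ((1 - ‖x‖ ^ 2 : ℝ) : ℂ) (Or.inr (by exact_mod_cast hA.ne'))
    rw [norm_comb_sq] at h2
    simp only [← hs] at h2
    have e1 : ((starRingEnd ℂ) s * ((1 - ‖x‖ ^ 2 : ℝ) : ℂ) * s).re = (1 - ‖x‖ ^ 2) * ‖s‖ ^ 2 := by
      rw [hns]
      simp only [Complex.mul_re, Complex.conj_re, Complex.conj_im, Complex.ofReal_re, Complex.ofReal_im, Complex.mul_im]
      ring
    have e2 : ‖((1 - ‖x‖ ^ 2 : ℝ) : ℂ)‖ ^ 2 = (1 - ‖x‖ ^ 2) ^ 2 := by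
      rw [Complex.norm_real, Real.norm_eq_abs, sq_abs]
    rw [e1, e2] at h2
    have : 0 < (1 - ‖x‖ ^ 2) * ((1 - ‖x‖ ^ 2) * (1 - ‖y‖ ^ 2) - ‖s‖ ^ 2) := by nlinarith
    have := pos_of_mul_pos_right this hA.le
    linarith
  · rintro ⟨h1, h2⟩ α β hab
    have hA : 0 < 1 - ‖x‖ ^ 2 := by linarith
    simp only
    rw [norm_comb_sq, ← hs]
    have key : (1 - ‖x‖ ^ 2) * (‖α‖ ^ 2 + ‖β‖ ^ 2 - (‖α‖ ^ 2 * ‖x‖ ^ 2 + ‖β‖ ^ 2 * ‖y‖ ^ 2 + 2 * ((starRingEnd ℂ) α * β * s).re))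
      = ‖((1 - ‖x‖ ^ 2 : ℝ) : ℂ) * α - s * β‖ ^ 2 + ((1 - ‖x‖ ^ 2) * (1 - ‖y‖ ^ 2) - ‖s‖ ^ 2) * ‖β‖ ^ 2 := by
      rw [hns]
      simp only [← Complex.normSq_eq_norm_sq (_ - _), ← Complex.normSq_eq_norm_sq α, ← Complex.normSq_eq_norm_sq β, Complex.normSq_apply, Complex.mul_re, Complex.mul_im, Complex.sub_re, Complex.sub_im,
        Complex.conj_re, Complex.conj_im, Complex.ofReal_re, Complex.ofReal_im]
      ring
    have hpos : 0 < ‖((1 - ‖x‖ ^ 2 : ℝ) : ℂ) * α - s * β‖ ^ 2 + ((1 - ‖x‖ ^ 2) * (1 - ‖y‖ ^ 2) - ‖s‖ ^ 2) * ‖β‖ ^ 2 := by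
      by_cases hb : β = 0
      · subst hb
        have ha : α ≠ 0 := by simpa using hab
        have : ((1 - ‖x‖ ^ 2 : ℝ) : ℂ) ≠ 0 := by exact_mod_cast hA.ne'
        simp only [mul_zero, sub_zero, norm_zero]
        have := norm_pos_iff.2 (mul_ne_zero this ha)
        positivity
      · have := norm_pos_iff.2 hb
        have h3 : 0 < (1 - ‖x‖ ^ 2) * (1 - ‖y‖ ^ 2) - ‖s‖ ^ 2 := by linarith
        positivity
    rw [← key] at hpos
    have := pos_of_mul_pos_right hpos hA.le
    linarith

lemma isOpen_D2 : IsOpen (D2 X) := by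
  have : D2 X = {z : X × X | ‖z.1‖ ^ 2 < 1} ∩
      {z | ‖(inner ℂ z.1 z.2 : ℂ)‖ ^ 2 < (1 - ‖z.1‖ ^ 2) * (1 - ‖z.2‖ ^ 2)} := by
    ext ⟨x, y⟩
    exact mem_D2_iff x y
  rw [this]
  refine (isOpen_lt (by fun_prop) (by fun_prop)).inter (isOpen_lt ?_ (by fun_prop))
  exact ((continuous_fst.inner continuous_snd).norm).pow 2

lemma convex_D2 : Convex ℝ (D2 X) := by
  intro z hz w hw a b ha hb hab α β h
  have h1 := hz α β h
  have h2 := hw α β h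
  set M := √(‖α‖ ^ 2 + ‖β‖ ^ 2) with hM
  have h1' : ‖α • z.1 + β • z.2‖ < M := Real.lt_sqrt_of_sq_lt h1
  have h2' : ‖α • w.1 + β • w.2‖ < M := Real.lt_sqrt_of_sq_lt h2
  have hMs : M ^ 2 = ‖α‖ ^ 2 + ‖β‖ ^ 2 := Real.sq_sqrt (by positivity)
  have e : α • (a • z + b • w).1 + β • (a • z + b • w).2 =
      a • (α • z.1 + β • z.2) + b • (α • w.1 + β • w.2) := by
    simp only [Prod.fst_add, Prod.snd_add, Prod.smul_fst, Prod.smul_snd, smul_add]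
    simp only [smul_comm a, smul_comm b]
    abel
  have h3 : ‖α • (a • z + b • w).1 + β • (a • z + b • w).2‖ < M := by
    rw [e]
    have hb' : b = 1 - a := by linarith
    calc _ ≤ ‖a • (α • z.1 + β • z.2)‖ + ‖b • (α • w.1 + β • w.2)‖ := norm_add_le _ _
      _ = a * ‖α • z.1 + β • z.2‖ + b * ‖α • w.1 + β • w.2‖ := by
        rw [norm_smul, norm_smul, Real.norm_of_nonneg ha, Real.norm_of_nonneg hb]
      _ < M := by
        rcases eq_or_lt_of_le ha with h0 | h0
        · have : b = 1 := by linarith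
          rw [← h0, this]; simpa using h2'
        · have t1 := mul_lt_mul_of_pos_left h1' h0
          have t2 := mul_le_mul_of_nonneg_left h2'.le hb
          have : a * M + b * M = M := by rw [← add_mul, hab, one_mul]
          linarith
  rw [← hMs]
  exact pow_lt_pow_left₀ h3 (norm_nonneg _) two_ne_zero

lemma mem_D2_zero (x : X) : (x, (0 : X)) ∈ D2 X ↔ ‖x‖ < 1 := by
  rw [mem_D2_iff]
  have : ‖x‖ ^ 2 < 1 ↔ ‖x‖ < 1 := by
    rw [sq_lt_one_iff₀ (norm_nonneg x)]
  simp [this]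

lemma mem_D2_of_small (x y : X) (h : ‖x‖ ^ 2 + ‖y‖ ^ 2 < 1) : (x, y) ∈ D2 X := by
  rw [mem_D2_iff]
  refine ⟨by nlinarith [sq_nonneg ‖y‖], ?_⟩
  have h1 : ‖(inner ℂ x y : ℂ)‖ ≤ ‖x‖ * ‖y‖ := norm_inner_le_norm x y
  have h2 : ‖(inner ℂ x y : ℂ)‖ ^ 2 ≤ (‖x‖ * ‖y‖) ^ 2 := pow_le_pow_left₀ (norm_nonneg _) h1 2
  nlinarith

lemma norm_fst_lt {z : X × X} (h : z ∈ D2 X) : ‖z.1‖ < 1 := by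
  have : ‖z.1‖ ^ 2 < 1 := ((mem_D2_iff z.1 z.2).1 h).1
  exact (sq_lt_one_iff₀ (norm_nonneg _)).1 this

/-- The scale `√(1+|τ|²)`. -/
noncomputable def sig (τ : ℂ) : ℂ := ((√(1 + ‖τ‖ ^ 2) : ℝ) : ℂ)

lemma sig_sq (τ : ℂ) : sig τ * sig τ = 1 + τ * (starRingEnd ℂ) τ := by
  rw [sig, ← Complex.ofReal_mul, Real.mul_self_sqrt (by positivity), Complex.mul_conj]
  simp [Complex.normSq_eq_norm_sq]

lemma norm_sig_sq (τ : ℂ) : ‖sig τ‖ ^ 2 = 1 + ‖τ‖ ^ 2 := by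
  rw [sig, Complex.norm_real, Real.norm_eq_abs, sq_abs, Real.sq_sqrt (by positivity)]

lemma sig_ne (τ : ℂ) : sig τ ≠ 0 := by
  intro h
  have := norm_sig_sq τ
  rw [h] at this
  simp at this
  nlinarith [sq_nonneg ‖τ‖]

lemma sig_neg (τ : ℂ) : sig (-τ) = sig τ := by simp [sig]

/-- Unitary rotation of the two columns. -/
noncomputable def rot (τ : ℂ) (z : X × X) : X × X :=
  ((sig τ)⁻¹ • (z.1 - τ • z.2), (sig τ)⁻¹ • ((starRingEnd ℂ) τ • z.1 + z.2))

lemma differentiable_rot (τ : ℂ) : Differentiable ℂ (rot τ : X × X → X × X) := by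
  unfold rot; fun_prop

lemma rot_rot (τ : ℂ) (z : X × X) : rot τ (rot (-τ) z) = z := by
  have h := sig_ne τ
  have h2 := sig_sq τ
  have h3 : (sig τ)⁻¹ * (sig τ)⁻¹ * (1 + τ * (starRingEnd ℂ) τ) = 1 := by
    rw [← h2]; field_simp
  ext
  · simp only [rot, sig_neg, map_neg, neg_smul, sub_neg_eq_add]
    have : (sig τ)⁻¹ • ((sig τ)⁻¹ • (z.1 + τ • z.2) - τ • (sig τ)⁻¹ • (-((starRingEnd ℂ) τ • z.1) + z.2))
      = ((sig τ)⁻¹ * (sig τ)⁻¹ * (1 + τ * (starRingEnd ℂ) τ)) • z.1 := by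
      module
    rw [this, h3, one_smul]
  · simp only [rot, sig_neg, map_neg, neg_smul, sub_neg_eq_add]
    have : (sig τ)⁻¹ • ((starRingEnd ℂ) τ • (sig τ)⁻¹ • (z.1 + τ • z.2) + (sig τ)⁻¹ • (-((starRingEnd ℂ) τ • z.1) + z.2))
      = ((sig τ)⁻¹ * (sig τ)⁻¹ * (1 + τ * (starRingEnd ℂ) τ)) • z.2 := by
      module
    rw [this, h3, one_smul]

lemma rot_mem (τ : ℂ) {z : X × X} (hz : z ∈ D2 X) : rot τ z ∈ D2 X := by
  intro α β h
  have hs := sig_ne τ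
  have e : α • (rot τ z).1 + β • (rot τ z).2 =
      ((sig τ)⁻¹ * (α + β * (starRingEnd ℂ) τ)) • z.1 + ((sig τ)⁻¹ * (β - α * τ)) • z.2 := by
    simp only [rot]; module
  have hsum : ‖(sig τ)⁻¹ * (α + β * (starRingEnd ℂ) τ)‖ ^ 2 + ‖(sig τ)⁻¹ * (β - α * τ)‖ ^ 2
      = ‖α‖ ^ 2 + ‖β‖ ^ 2 := by
    have h1 : ‖α + β * (starRingEnd ℂ) τ‖ ^ 2 + ‖β - α * τ‖ ^ 2 = (1 + ‖τ‖ ^ 2) * (‖α‖ ^ 2 + ‖β‖ ^ 2) := by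
      simp only [← Complex.normSq_eq_norm_sq, Complex.normSq_apply, Complex.mul_re, Complex.mul_im, Complex.sub_re, Complex.sub_im, Complex.add_re, Complex.add_im,
        Complex.conj_re, Complex.conj_im]
      ring
    rw [norm_mul, norm_mul, mul_pow, mul_pow, ← mul_add, h1, norm_inv, inv_pow, norm_sig_sq]
    have : 1 + ‖τ‖ ^ 2 ≠ 0 := by positivity
    field_simp
  rw [e, ← hsum]
  apply hz
  by_contra hcon
  push Not at hcon
  rw [hcon.1, hcon.2] at hsum
  simp at hsum
  have h1 : ‖α‖ = 0 := by nlinarith [sq_nonneg ‖α‖, sq_nonneg ‖β‖]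
  have h2 : ‖β‖ = 0 := by nlinarith [sq_nonneg ‖α‖, sq_nonneg ‖β‖]
  simp at h1 h2
  tauto

end D2

section Ker
variable {X : Type*} [NormedAddCommGroup X] [InnerProductSpace ℂ X]
variable {V W : Type*} [NormedAddCommGroup V] [NormedSpace ℂ V] [NormedAddCommGroup W]
  [NormedSpace ℂ W]

/-- Vectors on which `g` is constant along the slice `{(x - τ y, y)}`. -/
def Ker (g : X × X → (V →L[ℂ] W)) (x : X) (τ : ℂ) : Submodule ℂ V where
  carrier := {a | ∀ y y', (x - τ • y, y) ∈ D2 X → (x - τ • y', y') ∈ D2 X →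
    g (x - τ • y, y) a = g (x - τ • y', y') a}
  zero_mem' := by intro y y' _ _; simp
  add_mem' := by
    intro a b ha hb y y' h h'
    rw [map_add, map_add, ha y y' h h', hb y y' h h']
  smul_mem' := by
    intro c a ha y y' h h'
    rw [map_smul, map_smul, ha y y' h h']

lemma mem_Ker {g : X × X → (V →L[ℂ] W)} {x : X} {τ : ℂ} {a : V} : a ∈ Ker g x τ ↔
    ∀ y y', (x - τ • y, y) ∈ D2 X → (x - τ • y', y') ∈ D2 X →
    g (x - τ • y, y) a = g (x - τ • y', y') a := Iff.rfl

lemma mem_Ker_iff {g : X × X → (V →L[ℂ] W)} {x : X} (hx : ‖x‖ < 1) {τ : ℂ} {a : V} : a ∈ Ker g x τ ↔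
    ∀ y, (x - τ • y, y) ∈ D2 X → g (x - τ • y, y) a = g (x, 0) a := by
  have h0 : (x - τ • (0 : X), (0 : X)) ∈ D2 X := by simpa [mem_D2_zero] using hx
  constructor
  · intro h y hy
    have := h y 0 hy h0
    simpa using this
  · intro h y y' hy hy'
    rw [h y hy, h y' hy']

lemma mem_Ker_zero_iff {g : X × X → (V →L[ℂ] W)} {x : X} (hx : ‖x‖ < 1) {a : V} : a ∈ Ker g x 0 ↔
    ∀ y, (x, y) ∈ D2 X → g (x, y) a = g (x, 0) a := by
  rw [mem_Ker_iff hx]; simp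

lemma Ker_rot_le (g : X × X → (V →L[ℂ] W)) (x : X) (τ : ℂ) :
    Ker (fun z => g (rot τ z)) ((sig τ)⁻¹ • x) 0 ≤ Ker g x τ := by
  intro a ha
  have key : ∀ y, (rot (-τ) (x - τ • y, y)).1 = (sig τ)⁻¹ • x := by
    intro y; simp [rot, sig_neg]
  intro y y' h h'
  have h1 := rot_mem (-τ) h
  have h2 := rot_mem (-τ) h'
  have e1 : rot (-τ) (x - τ • y, y) = ((sig τ)⁻¹ • x, (rot (-τ) (x - τ • y, y)).2) :=
    Prod.ext (key y) rfl
  have e2 : rot (-τ) (x - τ • y', y') = ((sig τ)⁻¹ • x, (rot (-τ) (x - τ • y', y')).2) :=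
    Prod.ext (key y') rfl
  have := ha (rot (-τ) (x - τ • y, y)).2 (rot (-τ) (x - τ • y', y')).2
    (by simpa [← e1] using h1) (by simpa [← e2] using h2)
  simp only [zero_smul, sub_zero] at this
  rw [← e1, ← e2, rot_rot, rot_rot] at this
  exact this

/-- Transpose. -/
noncomputable def tr (g : X × X → (V →L[ℂ] W)) :
    X × X → ((W →L[ℂ] ℂ) →L[ℂ] (V →L[ℂ] ℂ)) :=
  fun z => (ContinuousLinearMap.compL ℂ V W ℂ).flip (g z)

@[simp] lemma tr_apply (g : X × X → (V →L[ℂ] W)) (z : X × X) (c : W →L[ℂ] ℂ) (a : V) :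
    tr g z c a = c (g z a) := rfl

lemma tr_diff {g : X × X → (V →L[ℂ] W)} {s : Set (X × X)} (h : DifferentiableOn ℂ g s) :
    DifferentiableOn ℂ (tr g) s := by
  exact clm_comp_diff (A := V →L[ℂ] W) (B := (W →L[ℂ] ℂ) →L[ℂ] (V →L[ℂ] ℂ))
    (ContinuousLinearMap.compL ℂ V W ℂ).flip h

/-- Holomorphic maps into strict contractions which are proper in the sequential sense. -/
structure Good (g : X × X → (V →L[ℂ] W)) : Prop where
  diff : DifferentiableOn ℂ g (D2 X)
  contr : ∀ z ∈ D2 X, ∀ a : V, a ≠ 0 → ‖g z a‖ < ‖a‖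
  proper : ∀ (z : ℕ → X × X) (z0 : X × X) (L : V →L[ℂ] W), (∀ n, z n ∈ D2 X) →
    Tendsto z atTop (𝓝 z0) → z0 ∉ D2 X → Tendsto (fun n => g (z n)) atTop (𝓝 L) →
    ∃ a, ‖a‖ = 1 ∧ ‖L a‖ = 1

lemma Good.rot {g : X × X → (V →L[ℂ] W)} (h : Good g) (τ : ℂ) : Good (fun z => g (rot τ z)) where
  diff := h.diff.comp (differentiable_rot τ).differentiableOn (fun _ hz => rot_mem τ hz)
  contr := fun z hz a ha => h.contr _ (rot_mem τ hz) a ha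
  proper := by
    intro z z0 L hz hlim hz0 hL
    refine h.proper (fun n => TypeI.rot τ (z n)) (TypeI.rot τ z0) L (fun n => rot_mem τ (hz n))
      (((differentiable_rot τ).continuous.tendsto z0).comp hlim) ?_ hL
    intro hcon
    apply hz0
    have := rot_mem (-τ) hcon
    have e := rot_rot (-τ) z0
    rw [neg_neg] at e
    rwa [e] at this

lemma Good.norm_le {g : X × X → (V →L[ℂ] W)} (h : Good g) {z : X × X} (hz : z ∈ D2 X) (a : V) :
    ‖g z a‖ ≤ ‖a‖ := by
  by_cases ha : a = 0
  · simp [ha]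
  · exact (h.contr z hz a ha).le

end Ker
end TypeI

open Filter Topology

namespace TypeI

section HL
variable {X V W : Type*} [NormedAddCommGroup X] [NormedSpace ℂ X] [FiniteDimensional ℂ X]
  [NormedAddCommGroup V] [NormedSpace ℂ V] [FiniteDimensional ℂ V]
  [NormedAddCommGroup W] [NormedSpace ℂ W] [CompleteSpace W]

/-- Vectors on which `h` is constant on `Y ∩ ker ℓ`. -/
def hypE (Y : Set X) (h : X → (V →L[ℂ] W)) (ℓ : X →L[ℂ] ℂ) : Submodule ℂ V where
  carrier := {a | ∀ y ∈ Y, ℓ y = 0 → h y a = h 0 a}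
  zero_mem' := by intro y _ _; simp
  add_mem' := by
    intro a b ha hb y hy hy'
    rw [map_add, map_add, ha y hy hy', hb y hy hy']
  smul_mem' := by
    intro c a ha y hy hy'
    rw [map_smul, map_smul, ha y hy hy']

/-- Explicit points in the kernel of `ℓ`. -/
noncomputable def kpt (w w' : X) (ℓ : X →L[ℂ] ℂ) : X := ℓ w' • w - ℓ w • w'

lemma kpt_ker (w w' : X) (ℓ : X →L[ℂ] ℂ) : ℓ (kpt w w' ℓ) = 0 := by
  simp [kpt, mul_comm]

lemma continuous_kpt (w w' : X) : Continuous (kpt w w') := by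
  unfold kpt; fun_prop

lemma hyperplane (hd : Module.finrank ℂ V < Module.finrank ℂ X) {Y : Set X} (hYo : IsOpen Y)
    (hYc : Convex ℝ Y) (h0 : (0 : X) ∈ Y) {h : X → (V →L[ℂ] W)} (hh : DifferentiableOn ℂ h Y)
    {O : Set (X →L[ℂ] ℂ)} (hO : IsOpen O) (hne : ∃ ℓ ∈ O, ℓ ≠ 0) :
    ∃ O' ⊆ O, IsOpen O' ∧ O'.Nonempty ∧ (∀ ℓ ∈ O', ℓ ≠ 0) ∧
      ∀ ℓ ∈ O', ∀ a ∈ hypE Y h ℓ, ∀ y ∈ Y, h y a = h 0 a := by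
  set O0 : Set (X →L[ℂ] ℂ) := O ∩ {0}ᶜ with hO0
  have hO0o : IsOpen O0 := hO.inter isOpen_compl_singleton
  have hO0ne : O0.Nonempty := by
    obtain ⟨ℓ, h1, h2⟩ := hne
    exact ⟨ℓ, h1, h2⟩
  obtain ⟨ℓs, hℓs, hmin⟩ := WellFounded.has_min
    (measure (fun ℓ : X →L[ℂ] ℂ => Module.finrank ℂ (hypE Y h ℓ))).wf O0 hO0ne
  have hmin' : ∀ ℓ ∈ O0, Module.finrank ℂ (hypE Y h ℓs) ≤ Module.finrank ℂ (hypE Y h ℓ) :=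
    fun ℓ hℓ => not_lt.1 (hmin ℓ hℓ)
  let ι := {i : X × X × (W →L[ℂ] ℂ) // kpt i.1 i.2.1 ℓs ∈ Y}
  let φ : ι → (X →L[ℂ] ℂ) → (V →L[ℂ] ℂ) := fun i ℓ =>
    i.1.2.2.comp (h (kpt i.1.1 i.1.2.1 ℓ) - h 0)
  obtain ⟨r, i, e, hN, hker⟩ := sec_exists (fun k : ι => φ k ℓs)
  let ψ : (X →L[ℂ] ℂ) → Fin r → (V →L[ℂ] ℂ) := fun ℓ j => φ (i j) ℓ
  have hEs : kerAll (ψ ℓs) = hypE Y h ℓs := by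
    ext a
    change a ∈ kerAll (fun j => φ (i j) ℓs) ↔ _
    rw [hker]
    constructor
    · intro ha y hy hy0
      obtain ⟨w', hw'⟩ : ∃ w', ℓs w' ≠ 0 := by
        by_contra hcon
        push Not at hcon
        exact hℓs.2 (ContinuousLinearMap.ext hcon)
      have hk : kpt y ((ℓs w')⁻¹ • w') ℓs = y := by
        simp [kpt, hy0, hw']
      rw [← sub_eq_zero]
      refine (SeparatingDual.eq_zero_iff_forall_dual_eq_zero (R := ℂ) _).2 fun η => ?_
      have := ha ⟨(y, (ℓs w')⁻¹ • w', η), by simpa [hk] using hy⟩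
      simpa [φ, hk] using this
    · intro ha k
      have := ha _ k.2 (kpt_ker _ _ _)
      simp [φ, this]
  let O0' : Set (X →L[ℂ] ℂ) := O0 ∩ ⋂ j, {ℓ | kpt (i j).1.1 (i j).1.2.1 ℓ ∈ Y}
  have hO0'o : IsOpen O0' := hO0o.inter
    (isOpen_iInter_of_finite fun j => hYo.preimage (continuous_kpt _ _))
  have hψc : ContinuousOn ψ O0' := by
    refine continuousOn_pi.2 fun j => ?_
    have h1 : ContinuousOn (fun ℓ => h (kpt (i j).1.1 (i j).1.2.1 ℓ)) O0' :=
      hh.continuousOn.comp (continuous_kpt _ _).continuousOn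
        (fun ℓ hℓ => (Set.mem_iInter.1 hℓ.2 j))
    have h2 : ContinuousOn (fun ℓ => h (kpt (i j).1.1 (i j).1.2.1 ℓ) - h 0) O0' :=
      h1.sub continuousOn_const
    exact continuousOn_const.clm_comp h2
  let O1 : Set (X →L[ℂ] ℂ) := O0' ∩ ψ ⁻¹' {ψ | (secN e ψ).det ≠ 0}
  have hO1o : IsOpen O1 := hψc.isOpen_inter_preimage hO0'o
    (isOpen_ne_fun (differentiable_secN_det e).continuous continuous_const)
  have hψs : (secN e (ψ ℓs)).det ≠ 0 := by
    have : secN e (ψ ℓs) = 1 := hN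
    simp [this]
  have hℓs1 : ℓs ∈ O1 := ⟨⟨hℓs, Set.mem_iInter.2 fun j => (i j).2⟩, hψs⟩
  have hsec : ∀ ℓ ∈ O1, ∀ a, secA e a (ψ ℓ) ∈ hypE Y h ℓ := by
    intro ℓ hℓ a
    refine secA_mem e (ψ ℓ) (ψ ℓs) hℓ.2 hψs _ ?_ ?_ a
    · intro b hb
      rw [mem_kerAll]
      intro j
      have := hb _ (Set.mem_iInter.1 hℓ.1.2 j) (kpt_ker _ _ _)
      simp [ψ, φ, this]
    · rw [hEs]
      exact hmin' ℓ hℓ.1.1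
  have hsec0 : ∀ ℓ ∈ O1, ∀ a ∈ hypE Y h ℓ, secA e a (ψ ℓ) = (secN e (ψ ℓ)).det • a := by
    intro ℓ hℓ a ha
    refine secA_of_ker e _ a fun j => ?_
    have := ha _ (Set.mem_iInter.1 hℓ.1.2 j) (kpt_ker _ _ _)
    simp [ψ, φ, this]
  set S : Set V := ⋃ ℓ ∈ O1, (hypE Y h ℓ : Set V) with hS
  obtain ⟨b, hbS, hspan, hli⟩ := exists_linearIndependent ℂ S
  have hfin : b.Finite := hli.setFinite
  have := hfin.fintype
  have hx : ∀ a : b, ∃ ℓ ∈ O1, (a : V) ∈ hypE Y h ℓ := by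
    intro a
    have := hbS a.2
    simpa [hS] using this
  choose ℓ hℓ1 hℓa using hx
  have hcard : Fintype.card b ≤ Module.finrank ℂ V := hli.fintype_card_le_finrank
  obtain ⟨y1, hy1, hy1ne⟩ : ∃ y1 : X, (∀ a, ℓ a y1 = 0) ∧ y1 ≠ 0 := by
    have hk : LinearMap.ker (LinearMap.pi fun a => (ℓ a : X →ₗ[ℂ] ℂ)) ≠ ⊥ := by
      apply LinearMap.ker_ne_bot_of_finrank_lt
      rw [Module.finrank_fintype_fun_eq_card]
      omega
    obtain ⟨y, hy, hy'⟩ := Submodule.exists_mem_ne_zero_of_ne_bot hk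
    refine ⟨y, fun a => ?_, hy'⟩
    simpa using congrFun hy a
  obtain ⟨y0, hy0, hy0ne, hy0Y⟩ : ∃ y0 : X, (∀ a, ℓ a y0 = 0) ∧ y0 ≠ 0 ∧ y0 ∈ Y := by
    have hc : Tendsto (fun t : ℝ => (t : ℂ) • y1) (𝓝 0) (𝓝 0) := by
      have : Continuous (fun t : ℝ => (t : ℂ) • y1) := by fun_prop
      simpa using this.tendsto 0
    have h1 := hc.eventually (hYo.mem_nhds h0)
    have h2 : ∀ᶠ t : ℝ in 𝓝[≠] 0, (t : ℂ) • y1 ∈ Y ∧ t ≠ 0 :=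
      (h1.filter_mono nhdsWithin_le_nhds).and self_mem_nhdsWithin
    obtain ⟨t, ht, ht0⟩ := h2.exists
    refine ⟨(t : ℂ) • y1, fun a => by simp [hy1], smul_ne_zero (by exact_mod_cast ht0) hy1ne, ht⟩
  obtain ⟨ω, hω⟩ := SeparatingDual.exists_eq_one (R := ℂ) hy0ne
  let lam : b → X → (X →L[ℂ] ℂ) := fun a y => ℓ a - (ℓ a y / ω y) • ω
  have hlam0 : ∀ a, lam a y0 = ℓ a := fun a => by
    ext x
    simp [lam, hy0]
  have hlamc : ∀ a, Tendsto (lam a) (𝓝 y0) (𝓝 (ℓ a)) := by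
    intro a
    have : ContinuousAt (lam a) y0 := by
      simp only [lam]
      have hne : ω y0 ≠ 0 := by simp [hω]
      have : ContinuousAt (fun y => ℓ a y / ω y) y0 :=
        (ℓ a).continuous.continuousAt.div ω.continuous.continuousAt hne
      exact continuousAt_const.sub (this.smul continuousAt_const)
    rw [← hlam0 a]
    exact this
  let sg : X → b → V := fun y a => secA e (a : V) (ψ (lam a y))
  have hsgc : ContinuousAt sg y0 := by
    refine continuousAt_pi.2 fun a => ?_
    have h1 : ContinuousAt ψ (ℓ a) := hψc.continuousAt (hO0'o.mem_nhds (hℓ1 a).1)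
    have h2 : ContinuousAt (fun y => ψ (lam a y)) y0 := by
      have h3 : Tendsto (fun y => ψ (lam a y)) (𝓝 y0) (𝓝 (ψ (ℓ a))) := h1.tendsto.comp (hlamc a)
      unfold ContinuousAt
      simp only [hlam0 a]
      exact h3
    exact ((differentiable_secA e (a : V)).continuous.continuousAt).comp h2
  have hli0 : LinearIndependent ℂ (sg y0) := by
    have : sg y0 = fun a : b => (secN e (ψ (ℓ a))).det • (a : V) := by
      ext1 a
      simp only [sg, hlam0]
      exact hsec0 _ (hℓ1 a) _ (hℓa a)
    rw [this]
    exact hli.units_smul (fun a : b => Units.mk0 _ (hℓ1 a).2)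
  have hev1 : ∀ᶠ y in 𝓝 y0, LinearIndependent ℂ (sg y) :=
    hsgc.eventually (isOpen_setOfPred_linearIndependent.mem_nhds hli0)
  have hev2 : ∀ᶠ y in 𝓝 y0, ∀ a, lam a y ∈ O1 := by
    rw [eventually_all]
    intro a
    exact (hlamc a).eventually (hO1o.mem_nhds (hℓ1 a))
  have hev3 : ∀ᶠ y in 𝓝 y0, y ∈ Y := hYo.mem_nhds hy0Y
  have hev4 : ∀ᶠ y in 𝓝 y0, ω y ≠ 0 := by
    have : ω y0 ≠ 0 := by simp [hω]
    exact ω.continuous.continuousAt.eventually_ne this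
  have hev : ∀ᶠ y in 𝓝 y0, ∀ a ∈ Submodule.span ℂ S, h y a = h 0 a := by
    filter_upwards [hev1, hev2, hev3, hev4] with y e1 e2 e3 e4
    have hle : Submodule.span ℂ (Set.range (sg y)) ≤ Submodule.span ℂ S := by
      apply Submodule.span_mono
      rintro _ ⟨a, rfl⟩
      simp only [hS, Set.mem_iUnion]
      exact ⟨lam a y, e2 a, hsec _ (e2 a) _⟩
    have heq : Submodule.span ℂ (Set.range (sg y)) = Submodule.span ℂ S := by
      apply Submodule.eq_of_le_of_finrank_eq hle
      rw [← hspan, finrank_span_eq_card e1, finrank_span_set_eq_card hli, Set.toFinset_card]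
    intro a ha
    rw [← heq] at ha
    induction ha using Submodule.span_induction with
    | mem x hx =>
      obtain ⟨a, rfl⟩ := hx
      refine hsec _ (e2 a) _ y e3 ?_
      simp [lam, e4]
    | zero => simp
    | add x z _ _ hx hz => rw [map_add, map_add, hx, hz]
    | smul c x _ hx => rw [map_smul, map_smul, hx]
  refine ⟨O1, fun ℓ hℓ => hℓ.1.1.1, hO1o, ⟨ℓs, hℓs1⟩, fun ℓ hℓ => hℓ.1.1.2, ?_⟩
  intro ℓ' hℓ' a ha y hy
  have haS : a ∈ Submodule.span ℂ S := by
    apply Submodule.subset_span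
    simp only [hS, Set.mem_iUnion]
    exact ⟨ℓ', hℓ', ha⟩
  have := ident hYo hYc (f := fun y => h y a - h 0 a) (by fun_prop) hy0Y
    (hev.mono fun y hy => sub_eq_zero.2 (hy a haS)) y hy
  exact sub_eq_zero.1 this

end HL
end TypeI

open Filter Topology

namespace TypeI

section P4
variable {X : Type*} [NormedAddCommGroup X] [InnerProductSpace ℂ X]
variable {V W : Type*} [NormedAddCommGroup V] [NormedSpace ℂ V] [FiniteDimensional ℂ V]
  [NormedAddCommGroup W] [NormedSpace ℂ W] [CompleteSpace W]

lemma eq_of_dual {w w' : W} (h : ∀ η : W →L[ℂ] ℂ, η (w - w') = 0) : w = w' := by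
  rw [← sub_eq_zero]
  exact (SeparatingDual.eq_zero_iff_forall_dual_eq_zero (R := ℂ) _).2 h

lemma ker_semicont {g : X × X → (V →L[ℂ] W)} (hg : DifferentiableOn ℂ g (D2 X)) {x0 : X}
    (hx0 : ‖x0‖ < 1) : ∀ᶠ x in 𝓝 x0, ‖x‖ < 1 ∧
      Module.finrank ℂ (Ker g x 0) ≤ Module.finrank ℂ (Ker g x0 0) := by
  let ι := {i : X × (W →L[ℂ] ℂ) // (x0, i.1) ∈ D2 X}
  let φ : ι → X → (V →L[ℂ] ℂ) := fun i x => i.1.2.comp (g (x, i.1.1) - g (x, 0))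
  obtain ⟨r, i, e, hN, hker⟩ := sec_exists (fun k : ι => φ k x0)
  let ψ : X → Fin r → (V →L[ℂ] ℂ) := fun x j => φ (i j) x
  have hE : kerAll (ψ x0) = Ker g x0 0 := by
    ext a
    change a ∈ kerAll (fun j => φ (i j) x0) ↔ _
    rw [hker, mem_Ker_zero_iff hx0]
    constructor
    · intro ha y hy
      refine eq_of_dual fun η => ?_
      have := ha ⟨(y, η), hy⟩
      simpa [φ] using this
    · intro ha k
      have := ha _ k.2
      simp [φ, this]
  have hψc : ContinuousAt ψ x0 := by
    refine continuousAt_pi.2 fun j => ?_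
    have hc : ∀ y, (x0, y) ∈ D2 X → ContinuousAt (fun x => g (x, y)) x0 := by
      intro y hy
      have h1 : ContinuousAt g (x0, y) := hg.continuousOn.continuousAt (isOpen_D2.mem_nhds hy)
      exact ContinuousAt.comp (f := fun x => (x, y)) (g := g) h1 (by fun_prop)
    have h2 := (hc _ (i j).2).sub (hc 0 ((mem_D2_zero x0).2 hx0))
    exact continuousAt_const.clm_comp h2
  have hψs : (secN e (ψ x0)).det ≠ 0 := by
    have : secN e (ψ x0) = 1 := hN
    simp [this]
  have ev1 : ∀ᶠ x in 𝓝 x0, (secN e (ψ x)).det ≠ 0 :=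
    ((differentiable_secN_det e).continuous.continuousAt.comp hψc).eventually_ne hψs
  have ev2 : ∀ᶠ x in 𝓝 x0, ‖x‖ < 1 := continuous_norm.continuousAt.eventually_lt_const hx0
  have ev3 : ∀ᶠ x in 𝓝 x0, ∀ j, (x, (i j).1.1) ∈ D2 X := by
    rw [eventually_all]
    intro j
    have : ContinuousAt (fun x => (x, (i j).1.1)) x0 := by fun_prop
    exact this.eventually (isOpen_D2.mem_nhds (i j).2)
  filter_upwards [ev1, ev2, ev3] with x e1 e2 e3
  refine ⟨e2, ?_⟩
  have hle : Ker g x 0 ≤ kerAll (ψ x) := by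
    intro a ha
    rw [mem_kerAll]
    intro j
    have := (mem_Ker_zero_iff e2).1 ha _ (e3 j)
    simp [ψ, φ, this]
  have h1 := Submodule.finrank_mono hle
  have h2 := finrank_kerAll e _ e1
  have h3 := finrank_kerAll e _ hψs
  rw [hE] at h3
  omega

lemma slice_open (x : X) : IsOpen {y : X | (x, y) ∈ D2 X} :=
  isOpen_D2.preimage (by fun_prop : Continuous fun y : X => (x, y))

lemma slice_convex (x : X) : Convex ℝ {y : X | (x, y) ∈ D2 X} := by
  intro y hy y' hy' a b ha hb hab
  have := convex_D2 hy hy' ha hb hab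
  have e : a • (x, y) + b • (x, y') = (x, a • y + b • y') := by
    ext
    · simp [← add_smul, hab]
    · simp
  rwa [e] at this

lemma slice_diff {g : X × X → (V →L[ℂ] W)} (hg : DifferentiableOn ℂ g (D2 X)) (x : X) :
    DifferentiableOn ℂ (fun y => g (x, y)) {y : X | (x, y) ∈ D2 X} :=
  hg.comp (by fun_prop : Differentiable ℂ fun y : X => (x, y)).differentiableOn (fun _ h => h)

lemma ker_of_near {g : X × X → (V →L[ℂ] W)} (hg : DifferentiableOn ℂ g (D2 X)) {x : X}
    (hx : ‖x‖ < 1) {a : V} (h : ∀ᶠ y in 𝓝 (0 : X), g (x, y) a = g (x, 0) a) : a ∈ Ker g x 0 := by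
  rw [mem_Ker_zero_iff hx]
  intro y hy
  have hd := slice_diff hg x
  have := ident (slice_open x) (slice_convex x) (f := fun y => g (x, y) a - g (x, 0) a)
    ((hd.clm_apply (differentiableOn_const a)).sub_const _) ((mem_D2_zero x).2 hx) (h.mono fun y hy => sub_eq_zero.2 hy) y hy
  exact sub_eq_zero.1 this

lemma star0 {G : X × X → (V →L[ℂ] W)} (hG : DifferentiableOn ℂ G (D2 X)) {v : X} (hv : ‖v‖ < 1)
    (hmin : ∀ τ : ℂ, Module.finrank ℂ (Ker G v 0) ≤ Module.finrank ℂ (Ker G v τ))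
    (lam : V →L[ℂ] ℂ) (R0 : ℝ) (hR0 : 0 ≤ R0)
    (hlam : ∀ τ : ℂ, R0 < ‖τ‖ → ∀ c ∈ Ker G v τ, lam c = 0) : ∀ c ∈ Ker G v 0, lam c = 0 := by
  intro c hc
  set R := R0 + 1 with hR
  let ι := {i : X × (W →L[ℂ] ℂ) // ∀ τ : ℂ, ‖τ‖ < R → (v - τ • i.1, i.1) ∈ D2 X}
  let φ : ι → ℂ → (V →L[ℂ] ℂ) := fun i τ => i.1.2.comp (G (v - τ • i.1.1, i.1.1) - G (v, 0))
  obtain ⟨r, i, e, hN, hker⟩ := sec_exists (fun k : ι => φ k 0)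
  let ψ : ℂ → Fin r → (V →L[ℂ] ℂ) := fun x j => φ (i j) x
  have hsmall : ∀ᶠ y in 𝓝 (0 : X), ∀ τ : ℂ, ‖τ‖ < R → (v - τ • y, y) ∈ D2 X := by
    have hc : Tendsto (fun y : X => (‖v‖ + R * ‖y‖) ^ 2 + ‖y‖ ^ 2) (𝓝 0) (𝓝 (‖v‖ ^ 2)) := by
      have : Continuous (fun y : X => (‖v‖ + R * ‖y‖) ^ 2 + ‖y‖ ^ 2) := by fun_prop
      simpa using this.tendsto 0
    have hv1 : ‖v‖ ^ 2 < 1 := (sq_lt_one_iff₀ (norm_nonneg _)).2 hv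
    filter_upwards [hc.eventually_lt_const hv1] with y hy τ hτ
    apply mem_D2_of_small
    have h1 : ‖v - τ • y‖ ≤ ‖v‖ + R * ‖y‖ := by
      refine (norm_sub_le _ _).trans ?_
      rw [norm_smul]
      gcongr
    have h2 := pow_le_pow_left₀ (norm_nonneg _) h1 2
    linarith
  have hE : kerAll (ψ 0) = Ker G v 0 := by
    ext a
    change a ∈ kerAll (fun j => φ (i j) 0) ↔ _
    rw [hker]
    constructor
    · intro ha
      refine ker_of_near hG hv ?_
      filter_upwards [hsmall] with y hy
      refine eq_of_dual fun η => ?_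
      have := ha ⟨(y, η), hy⟩
      simpa [φ] using this
    · intro ha k
      have h1 := k.2 0 (by simp; positivity)
      have := (mem_Ker_zero_iff hv).1 ha k.1.1 (by simpa using h1)
      simp [φ, this]
  have hψ0 : secN e (ψ 0) = 1 := hN
  have hψs : (secN e (ψ 0)).det ≠ 0 := by simp [hψ0]
  have hψd : DifferentiableOn ℂ ψ (Metric.ball 0 R) := by
    refine differentiableOn_pi.2 fun j => ?_
    have h1 : DifferentiableOn ℂ (fun τ : ℂ => G (v - τ • (i j).1.1, (i j).1.1)) (Metric.ball 0 R) :=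
      hG.comp (by fun_prop : Differentiable ℂ fun τ : ℂ => (v - τ • (i j).1.1, (i j).1.1)).differentiableOn
        (fun τ hτ => (i j).2 τ (by simpa using hτ))
    have h2 : DifferentiableOn ℂ (fun τ : ℂ => G (v - τ • (i j).1.1, (i j).1.1) - G (v, 0))
      (Metric.ball 0 R) := h1.sub_const _
    exact (differentiableOn_const _).clm_comp h2
  have hF : DifferentiableOn ℂ (fun τ => (secN e (ψ τ)).det * lam (secA e c (ψ τ))) (Metric.ball 0 R) := by
    have h1 := (differentiable_secN_det e).comp_differentiableOn hψd
    have h2 := (differentiable_secA e c).comp_differentiableOn hψd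
    have h3 : DifferentiableOn ℂ (fun τ => lam (secA e c (ψ τ))) (Metric.ball 0 R) :=
      clm_comp_diff lam h2
    exact h1.mul h3
  have hz : ∀ τ : ℂ, R0 < ‖τ‖ → ‖τ‖ < R → (secN e (ψ τ)).det * lam (secA e c (ψ τ)) = 0 := by
    intro τ h1 h2
    by_cases h3 : (secN e (ψ τ)).det = 0
    · simp [h3]
    rw [hlam τ h1 _ (secA_mem e _ (ψ 0) h3 hψs (Ker G v τ) ?_ ?_ c), mul_zero]
    · intro a ha
      rw [mem_kerAll]
      intro j
      have := (mem_Ker_iff hv).1 ha _ ((i j).2 τ h2)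
      simp [ψ, φ, this]
    · rw [hE]; exact hmin τ
  have hmem : ((R0 + 1 / 2 : ℝ) : ℂ) ∈ Metric.ball (0 : ℂ) R := by
    rw [mem_ball_zero_iff, Complex.norm_real, Real.norm_of_nonneg (by positivity)]
    linarith
  have hev : ∀ᶠ τ in 𝓝 ((R0 + 1 / 2 : ℝ) : ℂ), (secN e (ψ τ)).det * lam (secA e c (ψ τ)) = 0 := by
    have hn : ‖((R0 + 1 / 2 : ℝ) : ℂ)‖ = R0 + 1 / 2 := by
      rw [Complex.norm_real, Real.norm_of_nonneg (by positivity)]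
    have t1 : ∀ᶠ τ : ℂ in 𝓝 ((R0 + 1 / 2 : ℝ) : ℂ), R0 < ‖τ‖ :=
      continuous_norm.continuousAt.eventually_const_lt (by simp only [hn]; linarith)
    have t2 : ∀ᶠ τ : ℂ in 𝓝 ((R0 + 1 / 2 : ℝ) : ℂ), ‖τ‖ < R :=
      continuous_norm.continuousAt.eventually_lt_const (by simp only [hn]; linarith)
    filter_upwards [t1, t2] with τ h1 h2 using hz τ h1 h2
  have := ident Metric.isOpen_ball (convex_ball 0 R) hF hmem hev 0 (by simp; positivity)
  rw [hψ0, secA_of_ker e _ c (mem_kerAll.1 (by rw [hE]; exact hc)), hψ0] at this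
  simpa using this

end P4

section P4b
variable {X : Type*} [NormedAddCommGroup X] [InnerProductSpace ℂ X]
variable {V W : Type*} [NormedAddCommGroup V] [NormedSpace ℂ V] [FiniteDimensional ℂ V]
  [NormedAddCommGroup W] [NormedSpace ℂ W] [FiniteDimensional ℂ W]

lemma finrank_dualc : Module.finrank ℂ (W →L[ℂ] ℂ) = Module.finrank ℂ W := by
  rw [← (LinearMap.toContinuousLinearMap (𝕜 := ℂ) (E := W) (F' := ℂ)).finrank_eq]
  exact Subspace.dual_finrank_eq

lemma star {g : X × X → (V →L[ℂ] W)} (hg : DifferentiableOn ℂ g (D2 X)) {v' v : X}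
    (hv' : ‖v'‖ < 1) (hv : ‖v‖ < 1)
    (hmin : ∀ τ : ℂ, Module.finrank ℂ (Ker (tr g) v' 0) ≤ Module.finrank ℂ (Ker (tr g) v' τ))
    {c : W →L[ℂ] ℂ} (hc : c ∈ Ker (tr g) v' 0) {a : V} (ha : a ∈ Ker g v 0) :
    c (g (v', 0) a) = c (g (v, 0) a) := by
  have hopen : ∀ᶠ y in 𝓝 (0 : X), (v, y) ∈ D2 X :=
    (slice_open v).mem_nhds ((mem_D2_zero v).2 hv)
  obtain ⟨ε, hε, hball⟩ := Metric.eventually_nhds_iff.1 hopen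
  have := star0 (tr_diff hg) hv' hmin
    (ContinuousLinearMap.apply ℂ ℂ (g (v', 0) a - g (v, 0) a)) (‖v' - v‖ / ε) (by positivity) ?_ c hc
  · simpa [sub_eq_zero] using this
  · intro τ hτ c hc
    have hτ0 : τ ≠ 0 := by
      intro h0
      rw [h0, norm_zero] at hτ
      have : 0 ≤ ‖v' - v‖ / ε := by positivity
      linarith
    have hτp : 0 < ‖τ‖ := norm_pos_iff.2 hτ0
    have hy : (v, τ⁻¹ • (v' - v)) ∈ D2 X := by
      apply hball
      rw [dist_zero_right, norm_smul, norm_inv, inv_mul_lt_iff₀ hτp]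
      rw [div_lt_iff₀ hε] at hτ
      exact hτ
    have e : v' - τ • τ⁻¹ • (v' - v) = v := by
      rw [smul_smul, mul_inv_cancel₀ hτ0, one_smul]; abel
    have h1 := (mem_Ker_iff hv').1 hc (τ⁻¹ • (v' - v)) (by rw [e]; exact hy)
    rw [e] at h1
    have h2 := (mem_Ker_zero_iff hv).1 ha _ hy
    have h3 := congrArg (fun f : V →L[ℂ] ℂ => f a) h1
    simp only [tr_apply] at h3
    rw [h2] at h3
    simp [h3]

lemma min_data [FiniteDimensional ℂ X] (hVX : Module.finrank ℂ V < Module.finrank ℂ X)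
    (hWX : Module.finrank ℂ W < Module.finrank ℂ X)
    (hex : ∃ g : X × X → (V →L[ℂ] W), Good g) :
    ∃ (g : X × X → (V →L[ℂ] W)) (x1 : X) (ℓ1 : X →L[ℂ] ℂ), Good g ∧ ‖x1‖ < 1 ∧ ℓ1 ≠ 0 ∧
      (∀ a, (∀ y, (x1, y) ∈ D2 X → ℓ1 y = 0 → g (x1, y) a = g (x1, 0) a) → a ∈ Ker g x1 0) ∧
      (∀ c, (∀ y, (x1, y) ∈ D2 X → ℓ1 y = 0 → tr g (x1, y) c = tr g (x1, 0) c) →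
        c ∈ Ker (tr g) x1 0) ∧
      (∀ᶠ x in 𝓝 x1, ‖x‖ < 1 ∧
        Module.finrank ℂ (Ker g x1 0) ≤ Module.finrank ℂ (Ker g x 0) ∧
        Module.finrank ℂ (Ker (tr g) x1 0) ≤ Module.finrank ℂ (Ker (tr g) x 0) ∧
        ∀ c ∈ Ker (tr g) x 0, ∀ v, ‖v‖ < 1 → ∀ a ∈ Ker g v 0,
          c (g (x, 0) a) = c (g (v, 0) a)) := by
  have hcW : CompleteSpace W := FiniteDimensional.complete ℂ W
  let S : Set ((X × X → (V →L[ℂ] W)) × X) := {p | Good p.1 ∧ ‖p.2‖ < 1}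
  have hS : S.Nonempty := by
    obtain ⟨g, hg⟩ := hex
    exact ⟨(g, 0), hg, by simp⟩
  obtain ⟨⟨g, v0⟩, ⟨hg, hv0⟩, hm⟩ := WellFounded.has_min
    (measure (fun p : (X × X → (V →L[ℂ] W)) × X => Module.finrank ℂ (Ker (tr p.1) p.2 0))).wf S hS
  simp only at hg hv0
  set d := Module.finrank ℂ (Ker (tr g) v0 0) with hd
  have hm' : ∀ g' : X × X → (V →L[ℂ] W), Good g' → ∀ v : X, ‖v‖ < 1 →
      d ≤ Module.finrank ℂ (Ker (tr g') v 0) :=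
    fun g' hg' v hv => not_lt.1 (hm (g', v) ⟨hg', hv⟩)
  have hm2 : ∀ v : X, ‖v‖ < 1 → ∀ τ : ℂ, d ≤ Module.finrank ℂ (Ker (tr g) v τ) := by
    intro v hv τ
    have h1 := hm' _ (hg.rot τ) ((sig τ)⁻¹ • v) ?_
    · refine h1.trans (Submodule.finrank_mono ?_)
      exact Ker_rot_le (tr g) v τ
    · rw [norm_smul, norm_inv]
      have h2 := norm_sig_sq τ
      have h3 : 1 ≤ ‖sig τ‖ := by
        by_contra hcon
        push Not at hcon
        nlinarith [norm_nonneg (sig τ), sq_nonneg ‖τ‖]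
      have : ‖sig τ‖⁻¹ ≤ 1 := inv_le_one_of_one_le₀ h3
      nlinarith [norm_nonneg v]
  obtain ⟨U, hUsub, hUo, hv0U⟩ := eventually_nhds_iff.1 (ker_semicont (tr_diff hg.diff) hv0)
  obtain ⟨x1, hx1U, hmx⟩ := WellFounded.has_min
    (measure (fun x : X => Module.finrank ℂ (Ker g x 0))).wf U ⟨v0, hv0U⟩
  have hmx' : ∀ x ∈ U, Module.finrank ℂ (Ker g x1 0) ≤ Module.finrank ℂ (Ker g x 0) :=
    fun x hx => not_lt.1 (hmx x hx)
  have hx1 : ‖x1‖ < 1 := (hUsub x1 hx1U).1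
  have hY0 : (0 : X) ∈ {y : X | (x1, y) ∈ D2 X} := (mem_D2_zero x1).2 hx1
  obtain ⟨ℓ0, hℓ0⟩ : ∃ ℓ : X →L[ℂ] ℂ, ℓ ≠ 0 := by
    have hpos : 0 < Module.finrank ℂ X := by omega
    have := Module.finrank_pos_iff.1 hpos
    obtain ⟨x, hx⟩ := exists_ne (0 : X)
    obtain ⟨ω, hω⟩ := SeparatingDual.exists_eq_one (R := ℂ) hx
    refine ⟨ω, fun h => ?_⟩
    simp [h] at hω
  obtain ⟨O1, -, hO1o, ⟨ℓ2, hℓ2⟩, hO1ne, hO1⟩ := hyperplane hVX (slice_open x1) (slice_convex x1) hY0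
    (slice_diff hg.diff x1) isOpen_univ ⟨ℓ0, trivial, hℓ0⟩
  obtain ⟨O2, hO21, hO2o, ⟨ℓ1, hℓ1⟩, hO2ne, hO2⟩ := hyperplane (V := W →L[ℂ] ℂ)
    (by rw [finrank_dualc]; exact hWX) (slice_open x1) (slice_convex x1) hY0
    (slice_diff (tr_diff hg.diff) x1) hO1o ⟨ℓ2, hℓ2, hO1ne _ hℓ2⟩
  refine ⟨g, x1, ℓ1, hg, hx1, hO2ne _ hℓ1, ?_, ?_, ?_⟩
  · intro a ha
    rw [mem_Ker_zero_iff hx1]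
    exact hO1 ℓ1 (hO21 hℓ1) a ha
  · intro c hc
    rw [mem_Ker_zero_iff hx1]
    exact hO2 ℓ1 hℓ1 c hc
  · filter_upwards [hUo.mem_nhds hx1U] with x hx
    have hx' := hUsub x hx
    refine ⟨hx'.1, hmx' x hx, (hUsub x1 hx1U).2.trans (hm2 x hx'.1 0), ?_⟩
    intro c hc v hv a ha
    exact star hg.diff hx'.1 hv (fun τ => hx'.2.trans (hm2 x hx'.1 τ)) hc ha
end P4b
end TypeI

open Filter Topology

namespace TypeI

section P5
variable {X : Type*} [NormedAddCommGroup X] [InnerProductSpace ℂ X]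

/-- An affine disc reaching the boundary of the ball. -/
structure Disc (X : Type*) [NormedAddCommGroup X] [InnerProductSpace ℂ X] where
  p : X
  C : X
  orth : inner ℂ p C = (0 : ℂ)
  nrm : ‖p‖ ^ 2 + ‖C‖ ^ 2 = 1
  ne : C ≠ 0

/-- The point with parameter `t`. -/
noncomputable def Disc.x (D : Disc X) (t : ℂ) : X := D.p + t • D.C

/-- The associated functional. -/
noncomputable def Disc.l (D : Disc X) (t : ℂ) : X →L[ℂ] ℂ := t • innerSL ℂ D.p + innerSL ℂ D.C

lemma Disc.l_apply (D : Disc X) (t : ℂ) (y : X) :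
    D.l t y = t * inner ℂ D.p y + inner ℂ D.C y := by
  simp [Disc.l]

lemma disc_exists [CompleteSpace X] {x : X} (hx : ‖x‖ < 1) {ℓ : X →L[ℂ] ℂ} (hℓ : ℓ ≠ 0) :
    ∃ (D : Disc X) (t1 μ : ℂ), ‖t1‖ < 1 ∧ D.x t1 = x ∧ μ ≠ 0 ∧ ∀ y, D.l t1 y = μ * ℓ y := by
  obtain ⟨β, hβ⟩ := (InnerProductSpace.toDual ℂ X).surjective ℓ
  have hβ' : ∀ y, ℓ y = inner ℂ β y := by intro y; rw [← hβ]; simp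
  have hβ0 : β ≠ 0 := by
    rintro rfl
    apply hℓ
    ext y
    simp [hβ']
  set s : ℝ := ‖x‖ ^ 2 with hs
  have hs1 : s < 1 := (sq_lt_one_iff₀ (norm_nonneg _)).2 hx
  have hxx : inner ℂ x x = (s : ℂ) := by rw [inner_self_eq_norm_sq_to_K]; simp [hs]
  have h1s : (1 - s : ℂ) ≠ 0 := by
    have : (1 - s : ℝ) ≠ 0 := by linarith
    exact_mod_cast this
  set κ : ℂ := inner ℂ x β / (1 - s) with hκ
  set c0 : X := (1 - s : ℂ)⁻¹ • β - κ • ((1 : ℂ)) • x with hc0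
  have hxc0 : (1 - s : ℂ) • c0 + (inner ℂ x c0 : ℂ) • x = β := by
    have e1 : (inner ℂ x c0 : ℂ) = κ - κ * s := by
      rw [hc0, inner_sub_right, inner_smul_right, inner_smul_right, one_smul, hxx, hκ]
      field_simp
    rw [e1, hc0, smul_sub, smul_smul, mul_inv_cancel₀ h1s]
    module
  have hc0ne : c0 ≠ 0 := by
    intro h
    rw [h] at hxc0
    simp at hxc0
    exact hβ0 hxc0.symm
  have hn0 : 0 < ‖c0‖ := norm_pos_iff.2 hc0ne
  have hn0c : ((‖c0‖ : ℝ) : ℂ) ≠ 0 := by exact_mod_cast hn0.ne'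
  set c : X := ((‖c0‖ : ℝ) : ℂ)⁻¹ • c0 with hc
  have hcn : ‖c‖ = 1 := by
    rw [hc, norm_smul, norm_inv, Complex.norm_real, norm_norm, inv_mul_cancel₀ hn0.ne']
  have hcc : inner ℂ c c = (1 : ℂ) := by rw [inner_self_eq_norm_sq_to_K, hcn]; simp
  set k : ℂ := inner ℂ c x with hk
  set p : X := x - k • c with hp
  have hcp : inner ℂ c p = (0 : ℂ) := by
    rw [hp, inner_sub_right, inner_smul_right, hcc, mul_one, sub_self]
  have hpc : inner ℂ p c = (0 : ℂ) := by rw [← inner_conj_symm, hcp, map_zero]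
  have hxn : s = ‖p‖ ^ 2 + ‖k‖ ^ 2 := by
    have e : x = p + k • c := by rw [hp]; abel
    have := norm_add_sq_eq_norm_sq_add_norm_sq_of_inner_eq_zero (𝕜 := ℂ) p (k • c) (by
      rw [inner_smul_right, hpc, mul_zero])
    rw [← e, norm_smul, hcn] at this
    rw [hs]
    nlinarith
  have hρ2 : 0 < 1 - ‖p‖ ^ 2 := by nlinarith [sq_nonneg ‖k‖]
  set ρ : ℝ := √(1 - ‖p‖ ^ 2) with hρ
  have hρs : ρ ^ 2 = 1 - ‖p‖ ^ 2 := Real.sq_sqrt hρ2.le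
  have hρp : 0 < ρ := Real.sqrt_pos.2 hρ2
  have hρc : (ρ : ℂ) ≠ 0 := by exact_mod_cast hρp.ne'
  have hCn : ‖(ρ : ℂ) • c‖ = ρ := by
    rw [norm_smul, hcn, mul_one, Complex.norm_real, Real.norm_of_nonneg hρp.le]
  refine ⟨⟨p, (ρ : ℂ) • c, by rw [inner_smul_right, hpc, mul_zero], by rw [hCn, hρs]; ring,
    smul_ne_zero hρc (by rintro h; simp [h] at hcn)⟩, k / ρ, ((ρ * ‖c0‖ : ℝ) : ℂ)⁻¹, ?_, ?_, ?_, ?_⟩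
  · rw [norm_div, Complex.norm_real, Real.norm_of_nonneg hρp.le, div_lt_one hρp]
    by_contra hcon
    push Not at hcon
    nlinarith [norm_nonneg k]
  · simp only [Disc.x]
    rw [smul_smul, div_mul_cancel₀ _ hρc, hp]
    abel
  · have : (ρ * ‖c0‖ : ℝ) ≠ 0 := by positivity
    exact inv_ne_zero (by exact_mod_cast this)
  · intro y
    rw [Disc.l_apply, hβ' y]
    simp only
    have hconj : (starRingEnd ℂ) (inner ℂ x c0 : ℂ) = ‖c0‖ * k := by
      rw [inner_conj_symm, hk, hc, inner_smul_left]
      simp only [map_inv₀, Complex.conj_ofReal]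
      field_simp
    have hp' : (inner ℂ p y : ℂ) = inner ℂ x y - (starRingEnd ℂ) k * inner ℂ c y := by
      rw [hp, inner_sub_left, inner_smul_left]
    have hc' : (inner ℂ c0 y : ℂ) = ‖c0‖ * inner ℂ c y := by
      rw [hc, inner_smul_left]
      simp only [map_inv₀, Complex.conj_ofReal]
      field_simp
    have hβy : (inner ℂ β y : ℂ) = (1 - s) * (‖c0‖ * inner ℂ c y) + ‖c0‖ * k * inner ℂ x y := by
      rw [← hxc0, inner_add_left, inner_smul_left, inner_smul_left, hconj, hc']
      simp
    have hkk : k * (starRingEnd ℂ) k = s - 1 + ρ ^ 2 := by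
      rw [Complex.mul_conj, Complex.normSq_eq_norm_sq]
      have : ‖k‖ ^ 2 = s - 1 + ρ ^ 2 := by rw [hρs, hxn]; ring
      rw [this]; push_cast; ring
    have hCy : (inner ℂ ((ρ : ℂ) • c) y : ℂ) = ρ * inner ℂ c y := by
      rw [inner_smul_left, Complex.conj_ofReal]
    rw [hβy, hp', hCy]
    push_cast
    field_simp
    linear_combination (-(inner ℂ c y : ℂ)) * hkk

lemma Disc.norm_x_sq (D : Disc X) (t : ℂ) : ‖D.x t‖ ^ 2 = 1 - (1 - ‖t‖ ^ 2) * ‖D.C‖ ^ 2 := by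
  have := norm_add_sq_eq_norm_sq_add_norm_sq_of_inner_eq_zero (𝕜 := ℂ) D.p (t • D.C) (by
      rw [inner_smul_right, D.orth, mul_zero])
  rw [norm_smul] at this
  have h := D.nrm
  simp only [Disc.x]
  nlinarith

lemma Disc.norm_x_lt (D : Disc X) {t : ℂ} (ht : ‖t‖ < 1) : ‖D.x t‖ < 1 := by
  rw [← sq_lt_one_iff₀ (norm_nonneg _), D.norm_x_sq]
  have h1 := norm_pos_iff.2 D.ne
  have h2 : ‖t‖ ^ 2 < 1 := (sq_lt_one_iff₀ (norm_nonneg _)).2 ht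
  have : 0 < (1 - ‖t‖ ^ 2) * ‖D.C‖ ^ 2 := mul_pos (by linarith) (by positivity)
  linarith

lemma Disc.not_mem (D : Disc X) {t : ℂ} (ht : ‖t‖ = 1) : (D.x t, (0 : X)) ∉ D2 X := by
  rw [mem_D2_zero, ← sq_lt_one_iff₀ (norm_nonneg _), D.norm_x_sq, ht]
  simp

lemma Disc.dom (D : Disc X) {t : ℂ} (ht : ‖t‖ < 1) {y : X} (hy : D.l t y = 0)
    (hy2 : ‖y‖ ^ 2 < ‖D.C‖ ^ 2 / 2) : (D.x t, y) ∈ D2 X := by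
  rw [mem_D2_iff]
  refine ⟨(sq_lt_one_iff₀ (norm_nonneg _)).2 (D.norm_x_lt ht), ?_⟩
  have h2 : ‖t‖ ^ 2 < 1 := (sq_lt_one_iff₀ (norm_nonneg _)).2 ht
  have e : (inner ℂ (D.x t) y : ℂ) = ((1 - ‖t‖ ^ 2 : ℝ) : ℂ) * inner ℂ D.p y := by
    rw [Disc.l_apply] at hy
    have hc : (inner ℂ D.C y : ℂ) = - (t * inner ℂ D.p y) := by linear_combination hy
    rw [Disc.x, inner_add_left, inner_smul_left, hc]
    have : (starRingEnd ℂ) t * t = ((‖t‖ ^ 2 : ℝ) : ℂ) := by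
      rw [mul_comm, Complex.mul_conj, Complex.normSq_eq_norm_sq]
    push_cast at this ⊢
    linear_combination (- inner ℂ D.p y : ℂ) * this
  rw [e, norm_mul, Complex.norm_real, Real.norm_of_nonneg (by linarith), D.norm_x_sq]
  have hp1 : ‖D.p‖ ^ 2 ≤ 1 := by nlinarith [D.nrm, sq_nonneg ‖D.C‖]
  have hC1 : ‖D.C‖ ^ 2 ≤ 1 := by nlinarith [D.nrm, sq_nonneg ‖D.p‖]
  have hip : ‖(inner ℂ D.p y : ℂ)‖ ^ 2 ≤ ‖D.p‖ ^ 2 * ‖y‖ ^ 2 := by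
    rw [← mul_pow]
    exact pow_le_pow_left₀ (norm_nonneg _) (norm_inner_le_norm _ _) 2
  have hip' : ‖(inner ℂ D.p y : ℂ)‖ ^ 2 ≤ ‖y‖ ^ 2 := by nlinarith [sq_nonneg ‖y‖]
  set T := 1 - ‖t‖ ^ 2 with hT
  have hT0 : 0 < T := by linarith
  have hT1 : T ≤ 1 := by nlinarith [sq_nonneg ‖t‖]
  have key : T * ‖(inner ℂ D.p y : ℂ)‖ ^ 2 < ‖D.C‖ ^ 2 * (1 - ‖y‖ ^ 2) := by
    have h3 : T * ‖(inner ℂ D.p y : ℂ)‖ ^ 2 ≤ ‖y‖ ^ 2 := by nlinarith [sq_nonneg ‖(inner ℂ D.p y : ℂ)‖]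
    nlinarith [sq_nonneg ‖y‖]
  have := mul_lt_mul_of_pos_left key hT0
  nlinarith

lemma Disc.norm_l_le (D : Disc X) {t : ℂ} (ht : ‖t‖ < 1) (w : X) : ‖D.l t w‖ ≤ 2 * ‖w‖ := by
  have hp1 : ‖D.p‖ ≤ 1 := by
    rw [← sq_le_one_iff₀ (norm_nonneg _)]; nlinarith [D.nrm, sq_nonneg ‖D.C‖]
  have hC1 : ‖D.C‖ ≤ 1 := by
    rw [← sq_le_one_iff₀ (norm_nonneg _)]; nlinarith [D.nrm, sq_nonneg ‖D.p‖]
  rw [Disc.l_apply]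
  have h1 : ‖(inner ℂ D.p w : ℂ)‖ ≤ ‖D.p‖ * ‖w‖ := norm_inner_le_norm _ _
  have h2 : ‖(inner ℂ D.C w : ℂ)‖ ≤ ‖D.C‖ * ‖w‖ := norm_inner_le_norm _ _
  have h3 : ‖t * (inner ℂ D.p w : ℂ)‖ ≤ ‖w‖ := by
    rw [norm_mul]
    calc ‖t‖ * ‖(inner ℂ D.p w : ℂ)‖ ≤ 1 * (1 * ‖w‖) := by
          gcongr
          exact h1.trans (by gcongr)
      _ = ‖w‖ := by ring
  have h4 : ‖(inner ℂ D.C w : ℂ)‖ ≤ ‖w‖ := h2.trans (by nlinarith [norm_nonneg w])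
  calc _ ≤ _ := norm_add_le _ _
    _ ≤ 2 * ‖w‖ := by linarith

lemma Disc.kpt_small [FiniteDimensional ℂ X] (D : Disc X) (w' : X) : ∀ᶠ y in 𝓝 (0 : X), ∀ t : ℂ, ‖t‖ < 1 → ∀ z : ℂ, ‖z‖ < 2 →
    (D.x t, z • kpt y w' (D.l t)) ∈ D2 X := by
  have hc : Tendsto (fun y : X => (8 * ‖w'‖ * ‖y‖) ^ 2) (𝓝 0) (𝓝 0) := by
    have : Continuous (fun y : X => (8 * ‖w'‖ * ‖y‖) ^ 2) := by fun_prop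
    simpa using this.tendsto 0
  have hC : 0 < ‖D.C‖ ^ 2 / 2 := by
    have := norm_pos_iff.2 D.ne
    positivity
  filter_upwards [hc.eventually_lt_const hC] with y hy t ht z hz
  refine D.dom ht (by rw [map_smul, kpt_ker, smul_zero]) (lt_of_le_of_lt ?_ hy)
  refine pow_le_pow_left₀ (norm_nonneg _) ?_ 2
  have h1 : ‖kpt y w' (D.l t)‖ ≤ 4 * ‖w'‖ * ‖y‖ := by
    unfold kpt
    refine (norm_sub_le _ _).trans ?_
    rw [norm_smul, norm_smul]
    have a1 := D.norm_l_le ht w'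
    have a2 := D.norm_l_le ht y
    have b1 := mul_le_mul_of_nonneg_right a1 (norm_nonneg y)
    have b2 := mul_le_mul_of_nonneg_right a2 (norm_nonneg w')
    nlinarith
  rw [norm_smul]
  calc ‖z‖ * ‖kpt y w' (D.l t)‖ ≤ 2 * (4 * ‖w'‖ * ‖y‖) := by gcongr
    _ = _ := by ring

variable {V W : Type*} [NormedAddCommGroup V] [NormedSpace ℂ V] [FiniteDimensional ℂ V]
  [NormedAddCommGroup W] [NormedSpace ℂ W] [CompleteSpace W]

/-- The family of functionals along the disc. -/
noncomputable def Disc.psi (D : Disc X) (G : X × X → (V →L[ℂ] W)) {r : ℕ} (w w' : Fin r → X)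
    (η : Fin r → (W →L[ℂ] ℂ)) (t : ℂ) : Fin r → (V →L[ℂ] ℂ) := fun j =>
  (η j).comp (G (D.x t, kpt (w j) (w' j) (D.l t)) - G (D.x t, 0))

lemma Disc.diff_x (D : Disc X) : Differentiable ℂ D.x := by
  have : D.x = fun t => D.p + t • D.C := rfl
  rw [this]; fun_prop

lemma Disc.diff_kpt (D : Disc X) (w w' : X) : Differentiable ℂ (fun t => kpt w w' (D.l t)) := by
  simp only [kpt, Disc.l_apply]
  fun_prop

lemma Disc.diff_G0 (D : Disc X) {G : X × X → (V →L[ℂ] W)} (hG : DifferentiableOn ℂ G (D2 X)) :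
    DifferentiableOn ℂ (fun t => G (D.x t, 0)) (Metric.ball 0 1) :=
  hG.comp (D.diff_x.prodMk (differentiable_const 0)).differentiableOn
    (fun t ht => (mem_D2_zero _).2 (D.norm_x_lt (by simpa using ht)))

lemma Disc.diff_psi (D : Disc X) {G : X × X → (V →L[ℂ] W)} (hG : DifferentiableOn ℂ G (D2 X))
    {r : ℕ} {w w' : Fin r → X} (η : Fin r → (W →L[ℂ] ℂ))
    (hw : ∀ j, ∀ t : ℂ, ‖t‖ < 1 → ∀ z : ℂ, ‖z‖ < 2 → (D.x t, z • kpt (w j) (w' j) (D.l t)) ∈ D2 X) :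
    DifferentiableOn ℂ (D.psi G w w' η) (Metric.ball 0 1) := by
  refine differentiableOn_pi.2 fun j => ?_
  have h1 : DifferentiableOn ℂ (fun t => G (D.x t, kpt (w j) (w' j) (D.l t))) (Metric.ball 0 1) :=
    hG.comp (D.diff_x.prodMk (D.diff_kpt _ _)).differentiableOn
      (fun t ht => by simpa using hw j t (by simpa using ht) 1 (by simp))
  have h2 : DifferentiableOn ℂ (fun t => G (D.x t, kpt (w j) (w' j) (D.l t)) - G (D.x t, 0))
    (Metric.ball 0 1) := h1.sub (D.diff_G0 hG)
  exact (differentiableOn_const _).clm_comp h2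

lemma Disc.sections [FiniteDimensional ℂ X] (D : Disc X) {G : X × X → (V →L[ℂ] W)} (hG : DifferentiableOn ℂ G (D2 X))
    {t1 : ℂ} (ht1 : ‖t1‖ < 1) (hl : D.l t1 ≠ 0)
    (H1 : ∀ a, (∀ y, (D.x t1, y) ∈ D2 X → D.l t1 y = 0 → G (D.x t1, y) a = G (D.x t1, 0) a) →
      a ∈ Ker G (D.x t1) 0)
    (H2 : ∀ᶠ x in 𝓝 (D.x t1), ‖x‖ < 1 ∧
      Module.finrank ℂ (Ker G (D.x t1) 0) ≤ Module.finrank ℂ (Ker G x 0)) :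
    ∃ (r : ℕ) (w w' : Fin r → X) (η : Fin r → (W →L[ℂ] ℂ)) (e : Fin r → V),
      (∀ j, ∀ t : ℂ, ‖t‖ < 1 → ∀ z : ℂ, ‖z‖ < 2 → (D.x t, z • kpt (w j) (w' j) (D.l t)) ∈ D2 X) ∧
      (secN e (D.psi G w w' η t1)).det ≠ 0 ∧
      ∀ᶠ t in 𝓝 t1, ∀ a, secA e a (D.psi G w w' η t) ∈ Ker G (D.x t) 0 := by
  let ι := {i : X × X × (W →L[ℂ] ℂ) // ∀ t : ℂ, ‖t‖ < 1 → ∀ z : ℂ, ‖z‖ < 2 →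
    (D.x t, z • kpt i.1 i.2.1 (D.l t)) ∈ D2 X}
  obtain ⟨r, i, e, hN, hker⟩ := sec_exists (fun k : ι => k.1.2.2.comp
    (G (D.x t1, kpt k.1.1 k.1.2.1 (D.l t1)) - G (D.x t1, 0)))
  have hx1 := D.norm_x_lt ht1
  have hE : kerAll (D.psi G (fun j => (i j).1.1) (fun j => (i j).1.2.1) (fun j => (i j).1.2.2) t1)
      = Ker G (D.x t1) 0 := by
    ext a
    refine (hker a).trans ?_
    constructor
    · intro ha
      apply H1
      intro y hy hy0
      obtain ⟨w0, hw0⟩ : ∃ w', D.l t1 w' ≠ 0 := by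
        by_contra hcon
        push Not at hcon
        exact hl (ContinuousLinearMap.ext hcon)
      have hk : ∀ z : ℂ, kpt (z • y) ((D.l t1 w0)⁻¹ • w0) (D.l t1) = z • y := by
        intro z
        simp [kpt, hy0, hw0]
      have hU : IsOpen {z : ℂ | (D.x t1, z • y) ∈ D2 X} :=
        isOpen_D2.preimage (by fun_prop : Continuous fun z : ℂ => (D.x t1, z • y))
      have hUc : Convex ℝ {z : ℂ | (D.x t1, z • y) ∈ D2 X} := by
        intro z hz z' hz' a b ha hb hab
        have := slice_convex (D.x t1) hz hz' ha hb hab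
        simp only [Set.mem_ofPred_eq] at this ⊢
        convert this using 2
        rw [add_smul, smul_assoc, smul_assoc]
      have hd : DifferentiableOn ℂ (fun z : ℂ => G (D.x t1, z • y)) {z : ℂ | (D.x t1, z • y) ∈ D2 X} :=
        hG.comp (by fun_prop : Differentiable ℂ fun z : ℂ => (D.x t1, z • y)).differentiableOn
          (fun _ h => h)
      have hev : ∀ᶠ z in 𝓝 (0 : ℂ), G (D.x t1, z • y) a - G (D.x t1, 0) a = 0 := by
        have hc : Tendsto (fun z : ℂ => z • y) (𝓝 0) (𝓝 0) := by
          have : Continuous (fun z : ℂ => z • y) := by fun_prop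
          simpa using this.tendsto 0
        filter_upwards [hc.eventually (D.kpt_small ((D.l t1 w0)⁻¹ • w0))] with z hz
        rw [sub_eq_zero]
        refine eq_of_dual fun η => ?_
        have := ha ⟨(z • y, (D.l t1 w0)⁻¹ • w0, η), hz⟩
        simp only [hk] at this
        simpa using this
      have := ident hU hUc (f := fun z => G (D.x t1, z • y) a - G (D.x t1, 0) a)
        ((hd.clm_apply (differentiableOn_const a)).sub_const _) (z0 := 0)
        (by simpa [mem_D2_zero] using hx1) hev 1 (by simpa using hy)
      simpa [sub_eq_zero] using this
    · intro ha k
      have := (mem_Ker_zero_iff hx1).1 ha _ (by simpa using k.2 t1 ht1 1 (by simp))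
      simp [this]
  have hw : ∀ j, ∀ t : ℂ, ‖t‖ < 1 → ∀ z : ℂ, ‖z‖ < 2 →
      (D.x t, z • kpt (i j).1.1 (i j).1.2.1 (D.l t)) ∈ D2 X := fun j => (i j).2
  have hψs : (secN e (D.psi G (fun j => (i j).1.1) (fun j => (i j).1.2.1)
      (fun j => (i j).1.2.2) t1)).det ≠ 0 := by
    have : secN e (D.psi G (fun j => (i j).1.1) (fun j => (i j).1.2.1)
      (fun j => (i j).1.2.2) t1) = 1 := hN
    simp [this]
  refine ⟨r, fun j => (i j).1.1, fun j => (i j).1.2.1, fun j => (i j).1.2.2, e, hw, hψs, ?_⟩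
  have hball : Metric.ball (0 : ℂ) 1 ∈ 𝓝 t1 := Metric.isOpen_ball.mem_nhds (by simpa using ht1)
  have hψc := (D.diff_psi hG (fun j => (i j).1.2.2) hw).continuousOn.continuousAt hball
  have ev1 := ((differentiable_secN_det e).continuous.continuousAt.comp hψc).eventually_ne hψs
  have ev2 := D.diff_x.continuous.continuousAt.eventually H2
  filter_upwards [ev1, ev2, hball] with t e1 e2 e3 a
  have ht : ‖t‖ < 1 := by simpa using e3
  refine secA_mem e _ _ e1 hψs _ ?_ (by rw [hE]; exact e2.2) a
  intro a ha
  rw [mem_kerAll]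
  intro j
  have := (mem_Ker_zero_iff e2.1).1 ha _ (by simpa using hw j t ht 1 (by simp))
  simp [Disc.psi, this]

end P5
end TypeI

open Filter Topology

namespace TypeI

section P6
variable {X : Type*} [NormedAddCommGroup X] [InnerProductSpace ℂ X]

lemma vanish {V W : Type*} [NormedAddCommGroup V] [NormedSpace ℂ V] [FiniteDimensional ℂ V]
    [NormedAddCommGroup W] [NormedSpace ℂ W] [CompleteSpace W]
    {g : X × X → (V →L[ℂ] W)} (hg : DifferentiableOn ℂ g (D2 X)) (D : Disc X)
    {t1 : ℂ} (ht1 : ‖t1‖ < 1) {r r' : ℕ} {ψF : ℂ → Fin r → (V →L[ℂ] ℂ)}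
    {ψG : ℂ → Fin r' → ((W →L[ℂ] ℂ) →L[ℂ] ℂ)}
    (hψF : DifferentiableOn ℂ ψF (Metric.ball 0 1)) (hψG : DifferentiableOn ℂ ψG (Metric.ball 0 1))
    (e : Fin r → V) (e' : Fin r' → (W →L[ℂ] ℂ))
    (hF : ∀ᶠ t in 𝓝 t1, ∀ a, secA e a (ψF t) ∈ Ker g (D.x t) 0)
    (hG : ∀ᶠ t in 𝓝 t1, ∀ c, secA e' c (ψG t) ∈ Ker (tr g) (D.x t) 0)
    (H : ∀ᶠ x in 𝓝 (D.x t1), ∀ c ∈ Ker (tr g) x 0, ∀ v : X, ‖v‖ < 1 → ∀ a ∈ Ker g v 0,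
      c (g (x, 0) a) = c (g (v, 0) a)) (c : W →L[ℂ] ℂ) (a : V) (s t : ℂ) (hs : ‖s‖ < 1)
    (ht : ‖t‖ < 1) :
    (secA e' c (ψG s)) (g (D.x s, 0) (secA e a (ψF t)) - g (D.x t, 0) (secA e a (ψF t))) = 0 := by
  have hball : Metric.ball (0 : ℂ) 1 ∈ 𝓝 t1 := Metric.isOpen_ball.mem_nhds (by simpa using ht1)
  have hA : DifferentiableOn ℂ (fun t => secA e a (ψF t)) (Metric.ball 0 1) :=
    (differentiable_secA e a).comp_differentiableOn hψF
  have hC : DifferentiableOn ℂ (fun t => secA e' c (ψG t)) (Metric.ball 0 1) :=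
    (differentiable_secA e' c).comp_differentiableOn hψG
  have hg0 := D.diff_G0 hg
  have H' := D.diff_x.continuous.continuousAt.eventually H
  have step1 : ∀ᶠ t in 𝓝 t1, ∀ s ∈ Metric.ball (0 : ℂ) 1,
      (secA e' c (ψG s)) (g (D.x s, 0) (secA e a (ψF t)) - g (D.x t, 0) (secA e a (ψF t))) = 0 := by
    filter_upwards [hF, hball] with t h1 h2
    refine ident Metric.isOpen_ball (convex_ball _ _) ?_ (z0 := t1) (by simpa using ht1) ?_
    · exact hC.clm_apply ((hg0.clm_apply (differentiableOn_const _)).sub_const _)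
    · filter_upwards [hG, H'] with s h3 h4
      rw [map_sub, sub_eq_zero]
      exact h4 _ (h3 c) _ (D.norm_x_lt (by simpa using h2)) _ (h1 a)
  refine ident Metric.isOpen_ball (convex_ball (0 : ℂ) 1) (f := fun t =>
    (secA e' c (ψG s)) (g (D.x s, 0) (secA e a (ψF t)) - g (D.x t, 0) (secA e a (ψF t))))
    ?_ (z0 := t1) (by simpa using ht1) ?_ t (by simpa using ht)
  · exact (differentiableOn_const _).clm_apply
      (((differentiableOn_const _).clm_apply hA).sub (hg0.clm_apply hA))
  · filter_upwards [step1] with t h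
    exact h s (by simpa using hs)

lemma bc {φ : ℂ → ℂ} (hφ : DifferentiableOn ℂ φ (Metric.ball 0 2))
    (hb : ∀ z ∈ Metric.ball (0 : ℂ) 2, ‖φ z‖ ≤ 1) : ‖φ 1 - 1‖ ≤ 3 * ‖φ 0 - 1‖ := by
  refine le_of_forall_pos_le_add fun ε hε => ?_
  have h1 : Set.MapsTo (fun z => φ z - 1) (Metric.ball 0 2) {z : ℂ | z.re ≤ ε / 2} := by
    intro z hz
    have := (Complex.re_le_norm (φ z)).trans (hb z hz)
    simp only [Set.mem_ofPred_eq, Complex.sub_re, Complex.one_re]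
    linarith
  have := Complex.borelCaratheodory (half_pos hε) (hφ.sub_const 1) h1 (by norm_num : (0:ℝ) < 2)
    (z := 1) (by simp)
  simp only [norm_one] at this
  linarith

variable {V W : Type*} [NormedAddCommGroup V] [InnerProductSpace ℂ V] [FiniteDimensional ℂ V]
  [NormedAddCommGroup W] [InnerProductSpace ℂ W] [FiniteDimensional ℂ W]

lemma tendsto_of_inner {H : Type*} [NormedAddCommGroup H] [InnerProductSpace ℂ H]
    {u : ℕ → H} {b : H} (hu : ∀ n, ‖u n‖ ≤ 1) (hb : ‖b‖ = 1)
    (h : Tendsto (fun n => (inner ℂ b (u n) : ℂ).re) atTop (𝓝 1)) : Tendsto u atTop (𝓝 b) := by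
  rw [tendsto_iff_norm_sub_tendsto_zero]
  have h2 : Tendsto (fun n => √(2 - 2 * (inner ℂ b (u n) : ℂ).re)) atTop (𝓝 0) := by
    have := ((h.const_mul 2).const_sub 2).sqrt
    simpa using this
  refine squeeze_zero (fun n => norm_nonneg _) (fun n => ?_) h2
  refine Real.le_sqrt_of_sq_le ?_
  rw [norm_sub_rev, @norm_sub_sq ℂ, hb]
  have := pow_le_one₀ (n := 2) (norm_nonneg _) (hu n)
  simp only [RCLike.re_eq_complex_re]
  linarith

lemma lim_contr {M : ℕ → (V →L[ℂ] W)} (hM : ∀ n v, ‖M n v‖ ≤ ‖v‖) {a : V} {b : W}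
    (ha : ‖a‖ = 1) (hb : ‖b‖ = 1) (h : Tendsto (fun n => (inner ℂ b (M n a) : ℂ)) atTop (𝓝 1)) :
    Tendsto (fun n => M n a) atTop (𝓝 b) ∧
    Tendsto (fun n => (innerSL ℂ b).comp (M n)) atTop (𝓝 (innerSL ℂ a)) := by
  have := FiniteDimensional.complete ℂ V
  have := FiniteDimensional.complete ℂ W
  have hre : Tendsto (fun n => (inner ℂ b (M n a) : ℂ).re) atTop (𝓝 1) := by
    have := (Complex.continuous_re.tendsto 1).comp h
    rw [Complex.one_re] at this
    exact this
  refine ⟨tendsto_of_inner (fun n => (hM n a).trans ha.le) hb hre, ?_⟩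
  have h1 : Tendsto (fun n => (M n).adjoint b) atTop (𝓝 a) := by
    refine tendsto_of_inner (fun n => ?_) ha ?_
    · have h2 : ‖(M n).adjoint‖ ≤ 1 := by
        rw [LinearIsometryEquiv.norm_map]
        exact ContinuousLinearMap.opNorm_le_bound _ zero_le_one (by simpa using hM n)
      calc _ ≤ ‖(M n).adjoint‖ * ‖b‖ := ContinuousLinearMap.le_opNorm _ _
        _ ≤ 1 := by rw [hb, mul_one]; exact h2
    · refine hre.congr fun n => ?_
      rw [ContinuousLinearMap.adjoint_inner_right, ← inner_conj_symm, Complex.conj_re]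
  have h3 := ((innerSL ℂ (E := V)).continuous.tendsto a).comp h1
  refine h3.congr fun n => ?_
  ext v
  simp [ContinuousLinearMap.adjoint_inner_left]

lemma Good.lim {g : X × X → (V →L[ℂ] W)} (hg : Good g) {x k : ℕ → X}
    (hx : ∀ n, ∀ z : ℂ, ‖z‖ < 2 → (x n, z • k n) ∈ D2 X) {L : V →L[ℂ] W}
    (hL : Tendsto (fun n => g (x n, 0)) atTop (𝓝 L)) {a : V} {b : W} (hab : L a = b)
    (ha : ‖a‖ = 1) (hb : ‖b‖ = 1) :
    Tendsto (fun n => g (x n, k n) a) atTop (𝓝 b) ∧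
    Tendsto (fun n => (innerSL ℂ b).comp (g (x n, k n))) atTop (𝓝 (innerSL ℂ a)) := by
  refine lim_contr (fun n v => hg.norm_le (by simpa using hx n 1 (by simp)) v) ha hb ?_
  have h0 : Tendsto (fun n => (inner ℂ b (g (x n, 0) a) : ℂ)) atTop (𝓝 1) := by
    have h1 : Tendsto (fun n => g (x n, 0) a) atTop (𝓝 b) := by
      have := ((ContinuousLinearMap.apply ℂ W a).continuous.tendsto L).comp hL
      rw [← hab]
      exact this
    have := (tendsto_const_nhds (x := b)).inner (𝕜 := ℂ) h1
    rw [inner_self_eq_norm_sq_to_K, hb] at this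
    simpa using this
  rw [tendsto_iff_norm_sub_tendsto_zero] at h0 ⊢
  refine squeeze_zero (fun n => norm_nonneg _) (fun n => ?_) (by simpa using h0.const_mul 3)
  have hd : DifferentiableOn ℂ (fun z : ℂ => (inner ℂ b (g (x n, z • k n) a) : ℂ)) (Metric.ball 0 2) := by
    have h1 : DifferentiableOn ℂ (fun z : ℂ => g (x n, z • k n)) (Metric.ball 0 2) :=
      hg.diff.comp (by fun_prop : Differentiable ℂ fun z : ℂ => (x n, z • k n)).differentiableOn
        (fun z hz => hx n z (by simpa using hz))
    exact (differentiableOn_const (innerSL ℂ b)).clm_apply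
      (h1.clm_apply (differentiableOn_const a))
  have := bc hd (fun z hz => by
    refine (norm_inner_le_norm _ _).trans ?_
    rw [hb, one_mul]
    exact (hg.norm_le (hx n z (by simpa using hz)) a).trans ha.le)
  simpa using this

lemma Good.lim0 {g : X × X → (V →L[ℂ] W)} (hg : Good g) {x : ℕ → X}
    (hx : ∀ n, ‖x n‖ < 1) {L : V →L[ℂ] W}
    (hL : Tendsto (fun n => g (x n, 0)) atTop (𝓝 L)) {a : V} {b : W} (hab : L a = b)
    (ha : ‖a‖ = 1) (hb : ‖b‖ = 1) :
    Tendsto (fun n => g (x n, 0) a) atTop (𝓝 b) ∧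
    Tendsto (fun n => (innerSL ℂ b).comp (g (x n, 0))) atTop (𝓝 (innerSL ℂ a)) :=
  hg.lim (k := fun _ => 0) (fun n z _ => by simpa [mem_D2_zero] using hx n) hL hab ha hb

lemma Good.psiF {g : X × X → (V →L[ℂ] W)} (hg : Good g) (D : Disc X) {t : ℕ → ℂ}
    (ht : ∀ n, ‖t n‖ < 1) {L : V →L[ℂ] W}
    (hL : Tendsto (fun n => g (D.x (t n), 0)) atTop (𝓝 L)) {a : V} {b : W} (hab : L a = b)
    (ha : ‖a‖ = 1) (hb : ‖b‖ = 1) {r : ℕ} {w w' : Fin r → X} {η : Fin r → (W →L[ℂ] ℂ)}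
    (hw : ∀ j, ∀ t : ℂ, ‖t‖ < 1 → ∀ z : ℂ, ‖z‖ < 2 → (D.x t, z • kpt (w j) (w' j) (D.l t)) ∈ D2 X)
    {ψ : Fin r → (V →L[ℂ] ℂ)} (hψ : Tendsto (fun n => D.psi g w w' η (t n)) atTop (𝓝 ψ))
    (j : Fin r) : ψ j a = 0 := by
  have h1 := (hg.lim (fun n => hw j (t n) (ht n)) hL hab ha hb).1
  have h0 := (hg.lim0 (fun n => D.norm_x_lt (ht n)) hL hab ha hb).1
  have h2 := ((η j).continuous.tendsto _).comp (h1.sub h0)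
  have h3 := ((ContinuousLinearMap.apply ℂ ℂ a).continuous.tendsto _).comp (tendsto_pi_nhds.1 hψ j)
  have := tendsto_nhds_unique h3 (h2.congr fun n => by simp [Disc.psi])
  simpa using this

lemma Good.psiG {g : X × X → (V →L[ℂ] W)} (hg : Good g) (D : Disc X) {t : ℕ → ℂ}
    (ht : ∀ n, ‖t n‖ < 1) {L : V →L[ℂ] W}
    (hL : Tendsto (fun n => g (D.x (t n), 0)) atTop (𝓝 L)) {a : V} {b : W} (hab : L a = b)
    (ha : ‖a‖ = 1) (hb : ‖b‖ = 1) {r : ℕ} {w w' : Fin r → X}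
    {η : Fin r → ((V →L[ℂ] ℂ) →L[ℂ] ℂ)}
    (hw : ∀ j, ∀ t : ℂ, ‖t‖ < 1 → ∀ z : ℂ, ‖z‖ < 2 → (D.x t, z • kpt (w j) (w' j) (D.l t)) ∈ D2 X)
    {ψ : Fin r → ((W →L[ℂ] ℂ) →L[ℂ] ℂ)}
    (hψ : Tendsto (fun n => D.psi (tr g) w w' η (t n)) atTop (𝓝 ψ))
    (j : Fin r) : ψ j (innerSL ℂ b) = 0 := by
  have h1 := (hg.lim (fun n => hw j (t n) (ht n)) hL hab ha hb).2
  have h0 := (hg.lim0 (fun n => D.norm_x_lt (ht n)) hL hab ha hb).2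
  have h2 := ((η j).continuous.tendsto _).comp (h1.sub h0)
  have h3 := ((ContinuousLinearMap.apply ℂ ℂ (innerSL ℂ b)).continuous.tendsto _).comp
    (tendsto_pi_nhds.1 hψ j)
  have := tendsto_nhds_unique h3 (h2.congr fun n => by simp [Disc.psi]; rfl)
  simpa using this

end P6
end TypeI

open Filter Topology

namespace TypeI

lemma maxmod {Θ : ℂ → ℂ} (hΘ : DifferentiableOn ℂ Θ (Metric.ball 0 1)) {t1 : ℂ} (ht1 : ‖t1‖ < 1) :
    ∃ (t : ℕ → ℂ) (t0 : ℂ), (∀ n, ‖t n‖ < 1) ∧ Tendsto t atTop (𝓝 t0) ∧ ‖t0‖ = 1 ∧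
      ∀ n, ‖Θ t1‖ ≤ ‖Θ (t n)‖ := by
  have step : ∀ r : ℝ, ‖t1‖ < r → r < 1 → ∃ t : ℂ, ‖t‖ = r ∧ ‖Θ t1‖ ≤ ‖Θ t‖ := by
    intro r h1 h2
    have h0 : 0 < r := (norm_nonneg _).trans_lt h1
    have hsub : closure (Metric.ball (0 : ℂ) r) ⊆ Metric.ball 0 1 := by
      rw [closure_ball _ h0.ne']
      exact Metric.closedBall_subset_ball h2
    obtain ⟨z, hz, hmax⟩ := Complex.exists_mem_frontier_isMaxOn_norm
      (Metric.isBounded_ball (x := (0 : ℂ)) (r := r)) ⟨0, by simpa using h0⟩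
      (hΘ.mono hsub).diffContOnCl
    refine ⟨z, ?_, ?_⟩
    · rw [frontier_ball _ h0.ne'] at hz
      simpa using hz
    · exact hmax (subset_closure (by simpa using h1))
  obtain ⟨u, -, hu, hlim⟩ := exists_seq_strictMono_tendsto' ht1
  choose t ht1' ht2 using fun n => step (u n) (hu n).1 (hu n).2
  have hlt : ∀ n, ‖t n‖ < 1 := fun n => by rw [ht1']; exact (hu n).2
  obtain ⟨t0, -, φ, hφ, hconv⟩ := tendsto_subseq_of_bounded (Metric.isBounded_ball (x := (0 : ℂ)) (r := 1))
    (x := t) (fun n => by simpa using hlt n)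
  refine ⟨t ∘ φ, t0, fun n => hlt _, hconv, ?_, fun n => ht2 _⟩
  have h1 := hconv.norm
  have h2 := hlim.comp hφ.tendsto_atTop
  exact tendsto_nhds_unique h1 (h2.congr fun n => (ht1' _).symm)

lemma tendsto_clm {A B : Type*} [NormedAddCommGroup A] [NormedSpace ℂ A]
    [NormedAddCommGroup B] [NormedSpace ℂ B] {T : ℕ → (A →L[ℂ] B)} {T0 : A →L[ℂ] B} {u : ℕ → A}
    {u0 : A} (hT : Tendsto T atTop (𝓝 T0)) (hu : Tendsto u atTop (𝓝 u0)) :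
    Tendsto (fun n => T n (u n)) atTop (𝓝 (T0 u0)) :=
  (isBoundedBilinearMap_apply.continuous.tendsto (T0, u0)).comp (hT.prodMk_nhds hu)

section P7
variable {V W : Type*} [NormedAddCommGroup V] [InnerProductSpace ℂ V] [FiniteDimensional ℂ V]
  [NormedAddCommGroup W] [InnerProductSpace ℂ W] [FiniteDimensional ℂ W]

lemma span_inner {S : Set (V × W)}
    (h : ∀ u ∈ S, ∀ v ∈ S, (inner ℂ u.1 v.1 : ℂ) = inner ℂ u.2 v.2) :
    ∀ u ∈ Submodule.span ℂ S, ∀ v ∈ Submodule.span ℂ S, (inner ℂ u.1 v.1 : ℂ) = inner ℂ u.2 v.2 := by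
  have h1 : ∀ u ∈ S, ∀ v ∈ Submodule.span ℂ S, (inner ℂ u.1 v.1 : ℂ) = inner ℂ u.2 v.2 := by
    intro u hu v hv
    induction hv using Submodule.span_induction with
    | mem x hx => exact h u hu x hx
    | zero => simp
    | add x y _ _ hx hy => simp [inner_add_right, hx, hy]
    | smul c x _ hx => simp [inner_smul_right, hx]
  intro u hu v hv
  induction hu using Submodule.span_induction with
  | mem x hx => exact h1 x hx v hv
  | zero => simp
  | add x y _ _ hx hy => simp [inner_add_left, hx, hy]
  | smul c x _ hx => simp [inner_smul_left, hx]

lemma repr_fst {S : Submodule ℂ (V × W)} {m : ℕ} (bs : Module.Basis (Fin m) ℂ S) (u : S) :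
    u.1.1 = ∑ j, bs.repr u j • (bs j).1.1 := by
  have := congrArg ((LinearMap.fst ℂ V W).comp S.subtype) (bs.sum_repr u)
  rw [map_sum] at this
  simp only [map_smul] at this
  exact this.symm

lemma repr_snd {S : Submodule ℂ (V × W)} {m : ℕ} (bs : Module.Basis (Fin m) ℂ S) (u : S) :
    u.1.2 = ∑ j, bs.repr u j • (bs j).1.2 := by
  have := congrArg ((LinearMap.snd ℂ V W).comp S.subtype) (bs.sum_repr u)
  rw [map_sum] at this
  simp only [map_smul] at this
  exact this.symm

/-- The Gram-type matrix. -/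
noncomputable def gram {S : Submodule ℂ (V × W)} {m : ℕ} (bs : Module.Basis (Fin m) ℂ S)
    (A : V →L[ℂ] W) : Matrix (Fin m) (Fin m) ℂ :=
  Matrix.of fun i j => inner ℂ (bs i).1.1 (bs j).1.1 - inner ℂ (bs i).1.2 (A (bs j).1.1)

lemma gram_mulVec {S : Submodule ℂ (V × W)} {m : ℕ} (bs : Module.Basis (Fin m) ℂ S)
    (A : V →L[ℂ] W) (u : S) (i : Fin m) : (gram bs A *ᵥ bs.repr u) i =
      inner ℂ (bs i).1.1 u.1.1 - inner ℂ (bs i).1.2 (A u.1.1) := by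
  have hu : u.1.1 = ∑ j, bs.repr u j • (bs j).1.1 := repr_fst bs u
  rw [hu, map_sum, inner_sum, inner_sum, ← Finset.sum_sub_distrib]
  simp only [Matrix.mulVec, dotProduct, gram, Matrix.of_apply, map_smul, inner_smul_right]
  exact Finset.sum_congr rfl fun j _ => by ring

lemma gram_det_diff {S : Submodule ℂ (V × W)} {m : ℕ} (bs : Module.Basis (Fin m) ℂ S) :
    Differentiable ℂ fun A : V →L[ℂ] W => (gram bs A).det := by
  apply differentiable_det_of
  intro i j
  simp only [gram, Matrix.of_apply]
  have : Differentiable ℂ fun A : V →L[ℂ] W => (innerSL ℂ (bs i).1.2) (A (bs j).1.1) := by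
    fun_prop
  exact (differentiable_const _).sub this

lemma gram_det_ne {S : Submodule ℂ (V × W)} {m : ℕ} (bs : Module.Basis (Fin m) ℂ S)
    (hS : ∀ u ∈ S, ∀ v ∈ S, (inner ℂ u.1 v.1 : ℂ) = inner ℂ u.2 v.2)
    {A : V →L[ℂ] W} (hA : ∀ a, a ≠ 0 → ‖A a‖ < ‖a‖) : (gram bs A).det ≠ 0 := by
  intro h0
  obtain ⟨v, hv, hv0⟩ := Matrix.exists_mulVec_eq_zero_iff.2 h0
  obtain ⟨u, hu⟩ := bs.equivFun.surjective v
  have hur : (bs.repr u : Fin m → ℂ) = v := hu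
  have hune : u ≠ 0 := by
    rintro rfl
    apply hv
    rw [← hu, map_zero]
  rw [← hur] at hv0
  have h1 : ∀ i, (inner ℂ (bs i).1.1 u.1.1 : ℂ) - inner ℂ (bs i).1.2 (A u.1.1) = 0 := by
    intro i
    rw [← gram_mulVec, hv0]
    rfl
  have h2 : (inner ℂ u.1.1 u.1.1 : ℂ) - inner ℂ u.1.2 (A u.1.1) = 0 := by
    have e1 : u.1.1 = ∑ j, bs.repr u j • (bs j).1.1 := repr_fst bs u
    have e2 : u.1.2 = ∑ j, bs.repr u j • (bs j).1.2 := repr_snd bs u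
    have : ∀ y z, (inner ℂ u.1.1 y : ℂ) - inner ℂ u.1.2 z = ∑ j, (starRingEnd ℂ) (bs.repr u j) *
        (inner ℂ (bs j).1.1 y - inner ℂ (bs j).1.2 z) := by
      intro y z
      rw [e1, e2, sum_inner, sum_inner, ← Finset.sum_sub_distrib]
      refine Finset.sum_congr rfl fun j _ => ?_
      rw [inner_smul_left, inner_smul_left, mul_sub]
    rw [this]
    exact Finset.sum_eq_zero fun j _ => by rw [h1, mul_zero]
  have h3 := hS u.1 u.2 u.1 u.2
  have hn : ‖u.1.1‖ = ‖u.1.2‖ := by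
    rw [inner_self_eq_norm_sq_to_K, inner_self_eq_norm_sq_to_K] at h3
    have h4 : ‖u.1.1‖ ^ 2 = ‖u.1.2‖ ^ 2 := by exact_mod_cast h3
    exact (sq_eq_sq₀ (norm_nonneg _) (norm_nonneg _)).1 h4
  by_cases hu1 : u.1.1 = 0
  · apply hune
    have hu2 : u.1.2 = 0 := by
      rw [hu1, norm_zero] at hn
      exact norm_eq_zero.1 hn.symm
    exact Subtype.ext (Prod.ext hu1 hu2)
  · have h5 := hA _ hu1
    have h6 : ‖(inner ℂ u.1.1 u.1.1 : ℂ)‖ = ‖u.1.1‖ ^ 2 := by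
      rw [inner_self_eq_norm_sq_to_K]; simp
    rw [sub_eq_zero] at h2
    have h7 : ‖(inner ℂ u.1.2 (A u.1.1) : ℂ)‖ ≤ ‖u.1.2‖ * ‖A u.1.1‖ := norm_inner_le_norm _ _
    rw [← h2, h6, ← hn] at h7
    have := norm_pos_iff.2 hu1
    nlinarith

lemma gram_det_eq {S : Submodule ℂ (V × W)} {m : ℕ} (bs : Module.Basis (Fin m) ℂ S)
    (hS : ∀ u ∈ S, ∀ v ∈ S, (inner ℂ u.1 v.1 : ℂ) = inner ℂ u.2 v.2)
    {L : V →L[ℂ] W} {a : V} (ha : a ≠ 0) (h : (a, L a) ∈ S) : (gram bs L).det = 0 := by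
  refine Matrix.exists_mulVec_eq_zero_iff.1 ⟨bs.repr ⟨_, h⟩, ?_, ?_⟩
  · intro h0
    have h1 : bs.repr ⟨_, h⟩ = 0 := DFunLike.coe_injective h0
    rw [LinearEquiv.map_eq_zero_iff] at h1
    have := congrArg (fun u : S => u.1.1) h1
    exact ha this
  · ext i
    rw [gram_mulVec]
    simp only [Pi.zero_apply, sub_eq_zero]
    exact hS _ (bs i).2 _ h

variable {X : Type*} [NormedAddCommGroup X] [InnerProductSpace ℂ X]

lemma psi_bdd {V W : Type*} [NormedAddCommGroup V] [NormedSpace ℂ V]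
    [NormedAddCommGroup W] [NormedSpace ℂ W] (D : Disc X) {G : X × X → (V →L[ℂ] W)}
    (hG : ∀ z ∈ D2 X, ‖G z‖ ≤ 1) {r : ℕ} {w w' : Fin r → X} (η : Fin r → (W →L[ℂ] ℂ))
    (hw : ∀ j, ∀ t : ℂ, ‖t‖ < 1 → ∀ z : ℂ, ‖z‖ < 2 → (D.x t, z • kpt (w j) (w' j) (D.l t)) ∈ D2 X)
    {t : ℂ} (ht : ‖t‖ < 1) : ‖D.psi G w w' η t‖ ≤ ∑ j, ‖η j‖ * 2 := by
  refine (pi_norm_le_iff_of_nonneg (by positivity)).2 fun j => ?_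
  refine le_trans ?_ (Finset.single_le_sum (f := fun j => ‖η j‖ * 2) (fun _ _ => by positivity)
    (Finset.mem_univ j))
  refine (ContinuousLinearMap.opNorm_comp_le _ _).trans ?_
  gcongr
  refine (norm_sub_le _ _).trans ?_
  have h1 := hG _ (by simpa using hw j t ht 1 (by simp))
  have h2 := hG _ ((mem_D2_zero _).2 (D.norm_x_lt ht))
  linarith

variable [FiniteDimensional ℂ X]

theorem no_good (hVX : Module.finrank ℂ V < Module.finrank ℂ X)
    (hWX : Module.finrank ℂ W < Module.finrank ℂ X) : ¬ ∃ g : X × X → (V →L[ℂ] W), Good g := by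
  intro hex
  have := FiniteDimensional.complete ℂ X
  have := FiniteDimensional.complete ℂ W
  have := FiniteDimensional.complete ℂ V
  obtain ⟨g, x1, ℓ1, hg, hx1, hℓ1, HF, HG, Hev⟩ := min_data hVX hWX hex
  obtain ⟨D, t1, μ, ht1, hDx, hμ, hDl⟩ := disc_exists hx1 hℓ1
  have hl : D.l t1 ≠ 0 := by
    intro h
    apply hℓ1
    ext y
    have := hDl y
    rw [h] at this
    simpa [hμ] using this.symm
  have hl0 : ∀ y, ℓ1 y = 0 → D.l t1 y = 0 := fun y hy => by rw [hDl, hy, mul_zero]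
  subst hDx
  obtain ⟨rF, wF, wF', ηF, eF, hwF, hNF, hsF⟩ := D.sections hg.diff ht1 hl
    (fun a h => HF a fun y hy hy0 => h y hy (hl0 y hy0))
    (Hev.mono fun x h => ⟨h.1, h.2.1⟩)
  obtain ⟨rG, wG, wG', ηG, eG, hwG, hNG, hsG⟩ := D.sections (tr_diff hg.diff) ht1 hl
    (fun a h => HG a fun y hy hy0 => h y hy (hl0 y hy0))
    (Hev.mono fun x h => ⟨h.1, h.2.2.1⟩)
  have hdF := D.diff_psi hg.diff ηF hwF
  have hdG := D.diff_psi (tr_diff hg.diff) ηG hwG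
  have hvan := vanish hg.diff D ht1 hdF hdG eF eG hsF hsG (Hev.mono fun x h => h.2.2.2)
  let S0 : Set (V × W) := {u | ∃ (t : ℕ → ℂ) (L : V →L[ℂ] W) (ψF : Fin rF → (V →L[ℂ] ℂ))
    (ψG : Fin rG → ((W →L[ℂ] ℂ) →L[ℂ] ℂ)), (∀ n, ‖t n‖ < 1) ∧
    Tendsto (fun n => g (D.x (t n), 0)) atTop (𝓝 L) ∧
    Tendsto (fun n => D.psi g wF wF' ηF (t n)) atTop (𝓝 ψF) ∧
    Tendsto (fun n => D.psi (tr g) wG wG' ηG (t n)) atTop (𝓝 ψG) ∧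
    (secN eF ψF).det ≠ 0 ∧ (secN eG ψG).det ≠ 0 ∧ L u.1 = u.2 ∧ ‖u.1‖ = 1 ∧ ‖u.2‖ = 1}
  have hS0 : ∀ u ∈ S0, ∀ v ∈ S0, (inner ℂ u.1 v.1 : ℂ) = inner ℂ u.2 v.2 := by
    rintro ⟨a', b'⟩ ⟨s, L', ψF', ψG', hs, hL', hψF', hψG', hnF', hnG', hab', ha', hb'⟩
      ⟨a, b⟩ ⟨t, L, ψF, ψG, ht, hL, hψF, hψG, hnF, hnG, hab, ha, hb⟩
    simp only at *
    have kF : secA eF a ψF = (secN eF ψF).det • a :=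
      secA_of_ker _ _ _ fun j => hg.psiF D ht hL hab ha hb hwF hψF j
    have kG : secA eG (innerSL ℂ b') ψG' = (secN eG ψG').det • innerSL ℂ b' :=
      secA_of_ker _ _ _ fun j => hg.psiG D hs hL' hab' ha' hb' hwG hψG' j
    have lF := ((differentiable_secA eF a).continuous.tendsto ψF).comp hψF
    have lG := ((differentiable_secA eG (innerSL ℂ b')).continuous.tendsto ψG').comp hψG'
    have lim := tendsto_clm lG ((tendsto_clm hL' lF).sub (tendsto_clm hL lF))
    have z0 : secA eG (innerSL ℂ b') ψG' (L' (secA eF a ψF) - L (secA eF a ψF)) = 0 := by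
      refine tendsto_nhds_unique lim (tendsto_const_nhds.congr fun n => ?_)
      exact (hvan (innerSL ℂ b') a (s n) (t n) (hs n) (ht n)).symm
    rw [kF, kG] at z0
    have z1 : (inner ℂ b' (L' a) : ℂ) = inner ℂ b' b := by
      rw [map_smul, map_smul, ← smul_sub, map_smul, hab] at z0
      simp only [_root_.smul_apply, innerSL_apply_apply, smul_eq_mul, inner_sub_right] at z0
      have := (mul_eq_zero.1 ((mul_eq_zero.1 z0).resolve_left hnF)).resolve_left hnG'
      exact sub_eq_zero.1 this
    have z2 : (inner ℂ b' (L' a) : ℂ) = inner ℂ a' a := by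
      have h1 := (hg.lim0 (fun n => D.norm_x_lt (hs n)) hL' hab' ha' hb').2
      have h2 := tendsto_clm h1 (tendsto_const_nhds (x := a))
      have h3 := tendsto_clm (tendsto_const_nhds (x := innerSL ℂ b'))
        (tendsto_clm hL' (tendsto_const_nhds (x := a)))
      have := tendsto_nhds_unique h3 h2
      simpa using this
    rw [← z2, z1]
  have hS := span_inner hS0
  set S := Submodule.span ℂ S0 with hSdef
  let bs := Module.finBasis ℂ S
  let Θ : ℂ → ℂ := fun t => (gram bs (g (D.x t, 0))).det *
    ((secN eF (D.psi g wF wF' ηF t)).det * (secN eG (D.psi (tr g) wG wG' ηG t)).det)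
  have hΘ : DifferentiableOn ℂ Θ (Metric.ball 0 1) :=
    ((gram_det_diff bs).comp_differentiableOn (D.diff_G0 hg.diff)).mul
      (((differentiable_secN_det eF).comp_differentiableOn hdF).mul
        ((differentiable_secN_det eG).comp_differentiableOn hdG))
  have hΘ1 : Θ t1 ≠ 0 := mul_ne_zero
    (gram_det_ne bs hS (hg.contr _ ((mem_D2_zero _).2 (D.norm_x_lt ht1)))) (mul_ne_zero hNF hNG)
  obtain ⟨t, t0, ht, htl, ht0, hge⟩ := maxmod hΘ ht1
  have hgn : ∀ z ∈ D2 X, ‖g z‖ ≤ 1 := fun z hz =>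
    ContinuousLinearMap.opNorm_le_bound _ zero_le_one (by simpa using hg.norm_le hz)
  have htrn : ∀ z ∈ D2 X, ‖tr g z‖ ≤ 1 := fun z hz => by
    refine ContinuousLinearMap.opNorm_le_bound _ zero_le_one fun c => ?_
    have h1 : ‖tr g z c‖ ≤ ‖c‖ * ‖g z‖ := ContinuousLinearMap.opNorm_comp_le c (g z)
    nlinarith [hgn z hz, norm_nonneg c]
  let P := (V →L[ℂ] W) × (Fin rF → (V →L[ℂ] ℂ)) × (Fin rG → ((W →L[ℂ] ℂ) →L[ℂ] ℂ))
  have : ProperSpace P := FiniteDimensional.proper ℂ P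
  obtain ⟨⟨L, ψF, ψG⟩, -, φ, hφ, hconv⟩ := tendsto_subseq_of_bounded
    (Metric.isBounded_closedBall (x := (0 : P))
      (r := max 1 (max (∑ j, ‖ηF j‖ * 2) (∑ j, ‖ηG j‖ * 2))))
    (x := fun n => ((g (D.x (t n), 0), D.psi g wF wF' ηF (t n), D.psi (tr g) wG wG' ηG (t n)) : P))
    (fun n => by
      refine (mem_closedBall_zero_iff (E := (V →L[ℂ] W) × (Fin rF → (V →L[ℂ] ℂ)) ×
        (Fin rG → ((W →L[ℂ] ℂ) →L[ℂ] ℂ)))).2 ?_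
      refine max_le_max (hgn _ ((mem_D2_zero _).2 (D.norm_x_lt (ht n)))) (max_le_max ?_ ?_)
      · exact psi_bdd D hgn ηF hwF (ht n)
      · exact psi_bdd D htrn ηG hwG (ht n))
  have cL : Tendsto (fun n => g (D.x (t (φ n)), 0)) atTop (𝓝 L) :=
    (continuous_fst.tendsto _).comp hconv
  have cF : Tendsto (fun n => D.psi g wF wF' ηF (t (φ n))) atTop (𝓝 ψF) :=
    ((continuous_fst.comp continuous_snd).tendsto _).comp hconv
  have cG : Tendsto (fun n => D.psi (tr g) wG wG' ηG (t (φ n))) atTop (𝓝 ψG) :=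
    ((continuous_snd.comp continuous_snd).tendsto _).comp hconv
  have lim : Tendsto (fun n => Θ (t (φ n))) atTop
      (𝓝 ((gram bs L).det * ((secN eF ψF).det * (secN eG ψG).det))) :=
    (((gram_det_diff bs).continuous.tendsto L).comp cL).mul
      ((((differentiable_secN_det eF).continuous.tendsto ψF).comp cF).mul
        (((differentiable_secN_det eG).continuous.tendsto ψG).comp cG))
  have hne : (gram bs L).det * ((secN eF ψF).det * (secN eG ψG).det) ≠ 0 := by
    have h1 := ge_of_tendsto' lim.norm (fun n => hge (φ n))
    exact norm_pos_iff.1 ((norm_pos_iff.2 hΘ1).trans_le h1)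
  have hxl : Tendsto (fun n => (D.x (t (φ n)), (0 : X))) atTop (𝓝 (D.x t0, 0)) :=
    ((D.diff_x.continuous.tendsto t0).comp (htl.comp hφ.tendsto_atTop)).prodMk_nhds
      tendsto_const_nhds
  obtain ⟨a, ha, hLa⟩ := hg.proper _ _ L (fun n => (mem_D2_zero _).2 (D.norm_x_lt (ht (φ n)))) hxl
    (D.not_mem ht0) cL
  refine hne ?_
  have hmem : (a, L a) ∈ S := Submodule.subset_span
    ⟨fun n => t (φ n), L, ψF, ψG, fun n => ht _, cL, cF, cG,
      (mul_ne_zero_iff.1 (mul_ne_zero_iff.1 hne).2).1, (mul_ne_zero_iff.1 (mul_ne_zero_iff.1 hne).2).2,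
      rfl, ha, hLa⟩
  rw [gram_det_eq bs hS (by rintro rfl; simp at ha) hmem, zero_mul]

end P7
end TypeI

open Filter Topology

namespace TypeI

/-- Matrices as operators between Euclidean spaces. -/
noncomputable def toOp (m n : ℕ) : Matrix (Fin m) (Fin n) ℂ ≃L[ℂ]
    (EuclideanSpace ℂ (Fin n) →L[ℂ] EuclideanSpace ℂ (Fin m)) :=
  ((Matrix.toEuclideanLin (𝕜 := ℂ) (m := Fin m) (n := Fin n)).trans
    LinearMap.toContinuousLinearMap).toContinuousLinearEquiv

lemma toOp_apply (m n : ℕ) (Z : Matrix (Fin m) (Fin n) ℂ) (v : EuclideanSpace ℂ (Fin n)) :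
    toOp m n Z v = WithLp.toLp 2 (Z *ᵥ v.ofLp) := rfl

lemma star_dot_self {n : ℕ} (v : Fin n → ℂ) :
    Star.star v ⬝ᵥ v = ((‖(WithLp.toLp 2 v : EuclideanSpace ℂ (Fin n))‖ ^ 2 : ℝ) : ℂ) := by
  rw [EuclideanSpace.norm_sq_eq]
  simp only [dotProduct, Pi.star_apply]
  push_cast
  refine Finset.sum_congr rfl fun i _ => ?_
  rw [RCLike.star_def, Complex.conj_mul']

lemma mem_typeIDomain {m n : ℕ} {Z : Matrix (Fin m) (Fin n) ℂ} :
    Z ∈ typeIDomain m n ↔ ∀ v : EuclideanSpace ℂ (Fin n), v ≠ 0 → ‖toOp m n Z v‖ < ‖v‖ := by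
  have key : ∀ v : Fin n → ℂ, Star.star v ⬝ᵥ ((1 - Zᴴ * Z) *ᵥ v) =
      ((‖(WithLp.toLp 2 v : EuclideanSpace ℂ (Fin n))‖ ^ 2 -
        ‖toOp m n Z (WithLp.toLp 2 v)‖ ^ 2 : ℝ) : ℂ) := by
    intro v
    rw [Matrix.sub_mulVec, Matrix.one_mulVec, dotProduct_sub, ← Matrix.mulVec_mulVec,
      Matrix.dotProduct_mulVec, Matrix.vecMul_conjTranspose, star_star, star_dot_self,
      star_dot_self, toOp_apply]
    push_cast
    rfl
  have h1 : (1 - Zᴴ * Z).IsHermitian :=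
    Matrix.isHermitian_one.sub (Matrix.isHermitian_conjTranspose_mul_self Z)
  change (1 - Zᴴ * Z).PosDef ↔ _
  rw [Matrix.posDef_iff_dotProduct_mulVec]
  constructor
  · rintro ⟨-, h⟩ v hv
    have hv' : v.ofLp ≠ 0 := by
      intro h0
      exact hv (WithLp.ofLp_injective 2 h0)
    have := h hv'
    rw [key, Complex.zero_lt_real] at this
    exact lt_of_pow_lt_pow_left₀ 2 (norm_nonneg _) (by simpa using this)
  · intro h
    refine ⟨h1, fun v hv => ?_⟩
    rw [key, Complex.zero_lt_real]
    have := h (WithLp.toLp 2 v) (by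
      intro h0
      exact hv (WithLp.toLp_injective 2 h0))
    have := pow_lt_pow_left₀ this (norm_nonneg _) two_ne_zero
    linarith

/-- The matrix with first two columns `x`, `y`, and all the others zero. -/
noncomputable def colMat (p k : ℕ) (z : EuclideanSpace ℂ (Fin p) × EuclideanSpace ℂ (Fin p)) :
    Matrix (Fin p) (Fin (k + 2)) ℂ :=
  fun i => Fin.cons (z.1.ofLp i) (Fin.cons (z.2.ofLp i) 0)

lemma colMat_diff (p k : ℕ) : Differentiable ℂ (colMat p k) := by
  refine differentiable_pi.2 fun i => differentiable_pi.2 fun j => ?_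
  refine Fin.cases ?_ (fun j => Fin.cases ?_ (fun j => ?_) j) j
  · simp only [colMat, Fin.cons_zero]
    fun_prop
  · simp only [colMat, Fin.cons_zero, Fin.cons_succ]
    fun_prop
  · simp only [colMat, Fin.cons_succ]
    fun_prop

lemma toOp_colMat (p k : ℕ) (z : EuclideanSpace ℂ (Fin p) × EuclideanSpace ℂ (Fin p))
    (v : EuclideanSpace ℂ (Fin (k + 2))) :
    toOp p (k + 2) (colMat p k z) v = v.ofLp 0 • z.1 + v.ofLp 1 • z.2 := by
  ext i
  rw [toOp_apply]
  simp [Matrix.mulVec, dotProduct, colMat, Fin.sum_univ_succ, mul_comm]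

lemma mem_D2_colMat (p k : ℕ) (z : EuclideanSpace ℂ (Fin p) × EuclideanSpace ℂ (Fin p)) :
    z ∈ D2 (EuclideanSpace ℂ (Fin p)) ↔ colMat p k z ∈ typeIDomain p (k + 2) := by
  rw [mem_typeIDomain]
  constructor
  · intro h v hv
    rw [toOp_colMat]
    have hn : ‖v‖ ^ 2 = ‖v.ofLp 0‖ ^ 2 + ‖v.ofLp 1‖ ^ 2 + ∑ j : Fin k, ‖v.ofLp j.succ.succ‖ ^ 2 := by
      rw [EuclideanSpace.norm_sq_eq, Fin.sum_univ_succ, Fin.sum_univ_succ]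
      simp [add_assoc]
    have hs : 0 ≤ ∑ j : Fin k, ‖v.ofLp j.succ.succ‖ ^ 2 := Finset.sum_nonneg fun _ _ => by positivity
    by_cases h0 : v.ofLp 0 ≠ 0 ∨ v.ofLp 1 ≠ 0
    · have := h _ _ h0
      exact lt_of_pow_lt_pow_left₀ 2 (norm_nonneg _) (by linarith)
    · push Not at h0
      rw [h0.1, h0.2]
      simpa using hv
  · intro h α β hab
    set v : EuclideanSpace ℂ (Fin (k + 2)) := WithLp.toLp 2 (Fin.cons α (Fin.cons β 0)) with hv
    have e0 : v.ofLp 0 = α := rfl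
    have e1 : v.ofLp 1 = β := rfl
    have hn : ‖v‖ ^ 2 = ‖α‖ ^ 2 + ‖β‖ ^ 2 := by
      rw [EuclideanSpace.norm_sq_eq, Fin.sum_univ_succ, Fin.sum_univ_succ]
      simp [hv]
    have := h v (by
      intro h0
      rw [← e0, ← e1, h0] at hab
      simp at hab)
    rw [toOp_colMat, e0, e1] at this
    rw [← hn]
    exact pow_lt_pow_left₀ this (norm_nonneg _) two_ne_zero

lemma good_of_proper {p k p' q' : ℕ} {f : Matrix (Fin p) (Fin (k + 2)) ℂ → Matrix (Fin p') (Fin q') ℂ}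
    (hf : DifferentiableOn ℂ f (typeIDomain p (k + 2)))
    (hp : ProperOn f (typeIDomain p (k + 2)) (typeIDomain p' q')) :
    Good (fun z => toOp p' q' (f (colMat p k z))) where
  diff := (toOp p' q').differentiable.comp_differentiableOn
    (hf.comp (colMat_diff p k).differentiableOn fun z hz => (mem_D2_colMat p k z).1 hz)
  contr := fun z hz => mem_typeIDomain.1 (hp.1 ((mem_D2_colMat p k z).1 hz))
  proper := by
    intro z z0 L hz hlim hz0 hL
    have hD : ∀ n, colMat p k (z n) ∈ typeIDomain p (k + 2) := fun n => (mem_D2_colMat p k _).1 (hz n)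
    have hle : ∀ a, ‖L a‖ ≤ ‖a‖ := by
      intro a
      have h1 := (tendsto_clm hL (tendsto_const_nhds (x := a))).norm
      refine le_of_tendsto' h1 fun n => ?_
      by_cases ha : a = 0
      · simp [ha]
      · exact (mem_typeIDomain.1 (hp.1 (hD n)) a ha).le
    by_contra hcon
    push Not at hcon
    have hlt : ∀ a, a ≠ 0 → ‖L a‖ < ‖a‖ := by
      intro a ha
      refine lt_of_le_of_ne (hle a) fun heq => ?_
      have hpos := norm_pos_iff.2 ha
      have hi : ‖((‖a‖ : ℝ) : ℂ)⁻¹‖ = ‖a‖⁻¹ := by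
        rw [norm_inv, Complex.norm_real, norm_norm]
      refine hcon (((‖a‖ : ℝ) : ℂ)⁻¹ • a) ?_ ?_
      · rw [norm_smul, hi, inv_mul_cancel₀ hpos.ne']
      · rw [map_smul, norm_smul, hi, heq, inv_mul_cancel₀ hpos.ne']
    have hL' : (toOp p' q').symm L ∈ typeIDomain p' q' := by
      rw [mem_typeIDomain]
      simpa using hlt
    have hconv : Tendsto (fun n => f (colMat p k (z n))) atTop (𝓝 ((toOp p' q').symm L)) := by
      have := ((toOp p' q').symm.continuous.tendsto L).comp hL
      refine this.congr fun n => ?_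
      simp
    have hK := hp.2 (insert ((toOp p' q').symm L) (Set.range fun n => f (colMat p k (z n))))
      (by
        rintro y (rfl | ⟨n, rfl⟩)
        · exact hL'
        · exact hp.1 (hD n))
      hconv.isCompact_insert_range
    have hc : Tendsto (fun n => colMat p k (z n)) atTop (𝓝 (colMat p k z0)) :=
      ((colMat_diff p k).continuous.tendsto z0).comp hlim
    have := hK.isClosed.mem_of_tendsto hc (Eventually.of_forall fun n =>
      ⟨hD n, Or.inr ⟨n, rfl⟩⟩)
    exact hz0 ((mem_D2_colMat p k z0).2 this.1)

end TypeI

/-- Non-existence: if `2 ≤ q ≤ min {q', p'} ≤ max {q', p'} < p` and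
`min {q', p'} ≤ 2q - 1`, then there is no proper holomorphic map from `D^I_{p,q}`
to `D^I_{p',q'}`. -/
theorem stmt_3 (p q p' q' : ℕ) (h2q : 2 ≤ q) (hqmin : q ≤ min q' p')
    (hmaxp : max q' p' < p) (hmin : min q' p' ≤ 2 * q - 1) :
    ¬ ∃ f : Matrix (Fin p) (Fin q) ℂ → Matrix (Fin p') (Fin q') ℂ,
        DifferentiableOn ℂ f (typeIDomain p q) ∧
        ProperOn f (typeIDomain p q) (typeIDomain p' q') := by
  rintro ⟨f, hf, hp⟩
  obtain ⟨k, rfl⟩ : ∃ k, q = k + 2 := ⟨q - 2, by omega⟩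
  refine TypeI.no_good (X := EuclideanSpace ℂ (Fin p)) (V := EuclideanSpace ℂ (Fin q'))
    (W := EuclideanSpace ℂ (Fin p')) ?_ ?_ ⟨_, TypeI.good_of_proper hf hp⟩
  · simpa using lt_of_le_of_lt (le_max_left q' p') hmaxp
  · simpa using lt_of_le_of_lt (le_max_right q' p') hmaxp
end

section
/- Let p, q, p' be integers with 2 ≤ q ≤ p' < p. Then there does not exist any proper holomorphic map from D^I_{p,q} to D^I_{p',q} (equal rank q, strictly smaller p'). -/
open Matrix
open scoped ComplexOrder

attribute [local instance] Matrix.normedAddCommGroup Matrix.normedSpace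

/-- A holomorphic function vanishing at the center has nonpositive real part somewhere
on each small circle. -/
theorem exists_re_nonpos_on_sphere (ψ : ℂ → ℂ) (r : ℝ) (hr : 0 < r)
    (hψ : DifferentiableOn ℂ ψ (Metric.closedBall 0 r)) (h0 : ψ 0 = 0) :
    ∃ t : ℂ, ‖t‖ = r ∧ (ψ t).re ≤ 0 := by
  have hd : DiffContOnCl ℂ (fun t => Complex.exp (-ψ t)) (Metric.ball 0 r) := by
    apply DifferentiableOn.diffContOnCl
    rw [closure_ball _ hr.ne']
    exact hψ.neg.cexp
  obtain ⟨t, ht, hmax⟩ := Complex.exists_mem_frontier_isMaxOn_norm Metric.isBounded_ball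
    ⟨0, Metric.mem_ball_self hr⟩ hd
  rw [frontier_ball _ hr.ne'] at ht
  refine ⟨t, by simpa using ht, ?_⟩
  have := hmax (subset_closure (Metric.mem_ball_self hr))
  simp [h0, Complex.norm_exp] at this
  exact this

/-- If the target has smaller dimension, `‖f‖² - ε ‖z‖²` has no minimum on an open set. -/
theorem exists_lt_of_finrank_lt {E F : Type*} [NormedAddCommGroup E] [InnerProductSpace ℂ E]
    [NormedAddCommGroup F] [InnerProductSpace ℂ F] [FiniteDimensional ℂ E]
    [FiniteDimensional ℂ F] (hEF : Module.finrank ℂ F < Module.finrank ℂ E)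
    (f : E → F) (U : Set E) (hU : IsOpen U) (hf : DifferentiableOn ℂ f U)
    (z : E) (hz : z ∈ U) (ε : ℝ) (hε : 0 < ε) :
    ∃ z' ∈ U, ‖f z'‖ ^ 2 - ε * ‖z'‖ ^ 2 < ‖f z‖ ^ 2 - ε * ‖z‖ ^ 2 := by
  have hfz : DifferentiableAt ℂ f z := hf.differentiableAt (hU.mem_nhds hz)
  have hker := LinearMap.ker_ne_bot_of_finrank_lt (f := (fderiv ℂ f z).toLinearMap) hEF
  obtain ⟨w, hw, hw0⟩ := (Submodule.ne_bot_iff _).mp hker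
  have hw' : fderiv ℂ f z w = 0 := by simpa using hw
  have hwpos : 0 < ‖w‖ := norm_pos_iff.mpr hw0
  set l : ℂ → E := fun t => z + t • w with hl
  have hl0 : l 0 = z := by simp [hl]
  have hld : Differentiable ℂ l := by fun_prop
  have hlder : HasDerivAt l w 0 := by
    simpa [hl] using ((hasDerivAt_id (0 : ℂ)).smul_const w).const_add z
  have hg : HasDerivAt (fun t => f (l t)) 0 0 := by
    have h1 : HasFDerivAt f (fderiv ℂ f z) (l 0) := by rw [hl0]; exact hfz.hasFDerivAt
    have := h1.comp_hasDerivAt (0 : ℂ) hlder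
    rw [hw'] at this
    exact this
  have hopen : IsOpen (l ⁻¹' U) := hU.preimage hld.continuous
  obtain ⟨r₀, hr₀, hball⟩ := Metric.isOpen_iff.mp hopen 0 (by simpa [hl0] using hz)
  set c : ℝ := Real.sqrt ε * ‖w‖ / 2 with hc
  have hcpos : 0 < c := by positivity
  have hlo := (hasDerivAt_iff_isLittleO.mp hg).def hcpos
  obtain ⟨r₁, hr₁, hsmall⟩ := Metric.eventually_nhds_iff.mp hlo
  set r : ℝ := min r₀ r₁ / 2 with hrdef
  have hmin : 0 < min r₀ r₁ := lt_min hr₀ hr₁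
  have hr : 0 < r := by positivity
  have hrr₀ : r < r₀ := by have := min_le_left r₀ r₁; linarith
  have hrr₁ : r < r₁ := by have := min_le_right r₀ r₁; linarith
  have hsub : ∀ t ∈ Metric.closedBall (0 : ℂ) r, l t ∈ U := fun t ht =>
    hball (Metric.closedBall_subset_ball hrr₀ ht)
  have hgd : DifferentiableOn ℂ (fun t => f (l t)) (Metric.closedBall 0 r) :=
    hf.comp hld.differentiableOn hsub
  obtain ⟨t, ht, hre⟩ := exists_re_nonpos_on_sphere
    (fun t => 2 * (innerSL ℂ (f z) (f (l t) - f z)) - 2 * ε * (t * inner ℂ z w)) r hr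
    (by
      have h1 : DifferentiableOn ℂ (fun t => innerSL ℂ (f z) (f (l t) - f z))
          (Metric.closedBall 0 r) :=
        (innerSL ℂ (f z)).differentiable.comp_differentiableOn (hgd.sub_const _)
      exact (h1.const_mul 2).sub (by fun_prop))
    (by simp [hl0])
  refine ⟨l t, hsub t (by simp [ht]), ?_⟩
  have hb : ‖f (l t) - f z‖ ≤ c * r := by
    have := hsmall (y := t) (by simpa [ht] using hrr₁)
    simpa [hl0, ht] using this
  have e1 : ‖f (l t)‖ ^ 2 = ‖f z‖ ^ 2 + 2 * (inner ℂ (f z) (f (l t) - f z)).re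
      + ‖f (l t) - f z‖ ^ 2 := by
    have := norm_add_sq (𝕜 := ℂ) (f z) (f (l t) - f z)
    rwa [add_sub_cancel] at this
  have e2 : ‖l t‖ ^ 2 = ‖z‖ ^ 2 + 2 * (t * inner ℂ z w).re + (r * ‖w‖) ^ 2 := by
    have := norm_add_sq (𝕜 := ℂ) z (t • w)
    rw [inner_smul_right, norm_smul, ht] at this
    exact this
  have hre' : 2 * (inner ℂ (f z) (f (l t) - f z)).re - 2 * ε * (t * inner ℂ z w).re ≤ 0 := by
    have e : (2 * (innerSL ℂ (f z) (f (l t) - f z)) - 2 * ε * (t * inner ℂ z w) : ℂ).re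
        = 2 * (inner ℂ (f z) (f (l t) - f z)).re - 2 * ε * (t * inner ℂ z w).re := by
      rw [innerSL_apply_apply, Complex.sub_re]
      congr 1
      · rw [← Complex.re_ofReal_mul, Complex.ofReal_ofNat]
      · rw [← Complex.re_ofReal_mul, Complex.ofReal_mul, Complex.ofReal_ofNat]
    rw [← e]; exact hre
  have hsq : ‖f (l t) - f z‖ ^ 2 ≤ (c * r) ^ 2 := by gcongr
  have hc2 : (c * r) ^ 2 = ε * (r * ‖w‖) ^ 2 / 4 := by
    rw [hc]
    have := Real.sq_sqrt hε.le
    calc _ = (Real.sqrt ε) ^ 2 * (r * ‖w‖) ^ 2 / 4 := by ring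
      _ = _ := by rw [this]
  have hpos : 0 < ε * (r * ‖w‖) ^ 2 := by positivity
  rw [e1, e2]
  nlinarith

/-- No proper holomorphic maps from a bounded domain to a domain of smaller dimension. -/
theorem no_proper_inner {E F : Type*} [NormedAddCommGroup E] [InnerProductSpace ℂ E]
    [NormedAddCommGroup F] [InnerProductSpace ℂ F] [FiniteDimensional ℂ E]
    [FiniteDimensional ℂ F] (hEF : Module.finrank ℂ F < Module.finrank ℂ E)
    (f : E → F) (U : Set E) (V : Set F) (hU : IsOpen U) (hUb : Bornology.IsBounded U)
    (hUn : U.Nonempty) (hV : IsOpen V) (hf : DifferentiableOn ℂ f U) (hp : ProperOn f U V) :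
    False := by
  obtain ⟨a, ha⟩ := hUn
  obtain ⟨ρ, hρ, hball⟩ := Metric.nhds_basis_closedBall.mem_iff.mp (hV.mem_nhds (hp.1 ha))
  have := FiniteDimensional.proper ℂ F
  have hK := hp.2 _ hball (isCompact_closedBall (f a) ρ)
  obtain ⟨R, hRpos, hR⟩ := hUb.exists_pos_norm_le
  set ε : ℝ := ρ ^ 2 / (2 * R ^ 2) with hεd
  have hε : 0 < ε := by positivity
  have hεR : ε * R ^ 2 < ρ ^ 2 := by
    have : ε * R ^ 2 = ρ ^ 2 / 2 := by rw [hεd]; field_simp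
    have h2 : 0 < ρ ^ 2 := by positivity
    linarith
  have hfc := hf.sub_const (f a)
  have hcont : ContinuousOn (fun z => ‖f z - f a‖ ^ 2 - ε * ‖z‖ ^ 2)
      (U ∩ f ⁻¹' Metric.closedBall (f a) ρ) := by
    apply ContinuousOn.mono _ Set.inter_subset_left
    have := hfc.continuousOn
    exact (this.norm.pow 2).sub (by fun_prop)
  obtain ⟨z, hz, hmin⟩ := hK.exists_isMinOn ⟨a, ha, by simp [hρ.le]⟩ hcont
  obtain ⟨z', hz', hlt⟩ := exists_lt_of_finrank_lt hEF (fun z => f z - f a) U hU hfc z hz.1 ε hε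
  have hza := hmin (show a ∈ U ∩ f ⁻¹' Metric.closedBall (f a) ρ from ⟨ha, by simp [hρ.le]⟩)
  simp only [Set.mem_ofPred_eq, sub_self, norm_zero] at hza
  have hεa : 0 ≤ ε * ‖a‖ ^ 2 := by positivity
  by_cases h : ‖f z' - f a‖ ≤ ρ
  · have := hmin (show z' ∈ U ∩ f ⁻¹' Metric.closedBall (f a) ρ from
      ⟨hz', by simpa [dist_eq_norm] using h⟩)
    simp only [Set.mem_ofPred_eq] at this
    linarith
  · push Not at h
    have h1 : ρ ^ 2 < ‖f z' - f a‖ ^ 2 := by gcongr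
    have h2 : ε * ‖z'‖ ^ 2 ≤ ε * R ^ 2 := by have := hR z' hz'; gcongr
    have hlt' : ‖f z' - f a‖ ^ 2 - ε * ‖z'‖ ^ 2 < ‖f z - f a‖ ^ 2 - ε * ‖z‖ ^ 2 := hlt
    nlinarith

theorem no_proper {E F : Type*} [NormedAddCommGroup E] [NormedSpace ℂ E]
    [NormedAddCommGroup F] [NormedSpace ℂ F] [FiniteDimensional ℂ E]
    [FiniteDimensional ℂ F] (hEF : Module.finrank ℂ F < Module.finrank ℂ E)
    (f : E → F) (U : Set E) (V : Set F) (hU : IsOpen U) (hUb : Bornology.IsBounded U)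
    (hUn : U.Nonempty) (hV : IsOpen V) (hf : DifferentiableOn ℂ f U) (hp : ProperOn f U V) :
    False := by
  let e : EuclideanSpace ℂ (Fin (Module.finrank ℂ E)) ≃L[ℂ] E :=
    ContinuousLinearEquiv.ofFinrankEq finrank_euclideanSpace_fin
  let e' : EuclideanSpace ℂ (Fin (Module.finrank ℂ F)) ≃L[ℂ] F :=
    ContinuousLinearEquiv.ofFinrankEq finrank_euclideanSpace_fin
  refine no_proper_inner (by simpa using hEF) (fun x => e'.symm (f (e x))) (e ⁻¹' U) (e' ⁻¹' V)
    (hU.preimage e.continuous) ?_ ?_ (hV.preimage e'.continuous) ?_ ⟨?_, ?_⟩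
  · exact e.antilipschitz.isBounded_preimage hUb
  · obtain ⟨a, ha⟩ := hUn
    exact ⟨e.symm a, by simpa using ha⟩
  · exact e'.symm.differentiable.comp_differentiableOn
      (hf.comp e.differentiable.differentiableOn (fun x hx => hx))
  · intro x hx
    simpa using hp.1 hx
  · intro K hK hKc
    have h1 := hp.2 (e' '' K) (by rintro _ ⟨x, hx, rfl⟩; exact hK hx)
      (hKc.image e'.continuous)
    have h2 := e.toHomeomorph.isCompact_preimage.mpr h1
    have hs : e ⁻¹' U ∩ (fun x => e'.symm (f (e x))) ⁻¹' K
        = e.toHomeomorph ⁻¹' (U ∩ f ⁻¹' (e' '' K)) := ?_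
    · rw [hs]; exact h2
    ext x
    constructor
    · rintro ⟨hx, hx'⟩
      exact ⟨hx, _, hx', by simp⟩
    · rintro ⟨hx, y, hy, hxy⟩
      refine ⟨hx, ?_⟩
      have : e'.symm (f (e x)) = y := by
        rw [ContinuousLinearEquiv.symm_apply_eq]; exact hxy.symm
      simpa [this] using hy

theorem typeIDomain_quad {m n : ℕ} (Z : Matrix (Fin m) (Fin n) ℂ) (x : Fin n → ℂ) :
    star x ⬝ᵥ ((1 - Zᴴ * Z) *ᵥ x)
      = ((∑ j, ‖x j‖ ^ 2 - ∑ i, ‖(Z *ᵥ x) i‖ ^ 2 : ℝ) : ℂ) := by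
  have key : ∀ {k : ℕ} (v : Fin k → ℂ), star v ⬝ᵥ v = ((∑ j, ‖v j‖ ^ 2 : ℝ) : ℂ) := by
    intro k v
    simp [dotProduct, Complex.conj_mul']
  rw [Matrix.sub_mulVec, Matrix.one_mulVec, dotProduct_sub, ← Matrix.mulVec_mulVec,
    Matrix.dotProduct_mulVec, Matrix.vecMul_conjTranspose, star_star, key, key]
  push_cast
  rfl

theorem mem_typeIDomain_iff {m n : ℕ} (Z : Matrix (Fin m) (Fin n) ℂ) :
    Z ∈ typeIDomain m n ↔
      ∀ x : Fin n → ℂ, x ≠ 0 → ∑ i, ‖(Z *ᵥ x) i‖ ^ 2 < ∑ j, ‖x j‖ ^ 2 := by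
  unfold typeIDomain
  rw [Set.mem_ofPred_eq, Matrix.posDef_iff_dotProduct_mulVec]
  constructor
  · rintro ⟨-, h⟩ x hx
    have := h hx
    rw [typeIDomain_quad, Complex.zero_lt_real] at this
    linarith
  · intro h
    refine ⟨?_, fun x hx => ?_⟩
    · exact Matrix.isHermitian_one.sub (Matrix.isHermitian_conjTranspose_mul_self Z)
    · rw [typeIDomain_quad, Complex.zero_lt_real]
      have := h x hx
      linarith

theorem isOpen_typeIDomain (m n : ℕ) : IsOpen (typeIDomain m n) := by
  have hset : typeIDomain m n = {Z | ∀ x ∈ Metric.sphere (0 : Fin n → ℂ) 1,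
      ∑ i, ‖(Z *ᵥ x) i‖ ^ 2 < ∑ j, ‖x j‖ ^ 2} := by
    ext Z
    rw [mem_typeIDomain_iff]
    constructor
    · intro h x hx
      exact h x (by rintro rfl; simp at hx)
    · intro h x hx
      have hpos : 0 < ‖x‖ := norm_pos_iff.mpr hx
      have := h (((‖x‖⁻¹ : ℝ) : ℂ) • x) (by
        rw [mem_sphere_zero_iff_norm, norm_smul]; simp [hpos.ne'])
      rw [Matrix.mulVec_smul] at this
      simp only [Pi.smul_apply, norm_smul, mul_pow, ← Finset.mul_sum] at this
      refine lt_of_mul_lt_mul_left this (by positivity)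
  rw [hset, isOpen_iff_eventually]
  intro Z hZ
  apply (isCompact_sphere (0 : Fin n → ℂ) 1).eventually_forall_of_forall_eventually
  intro x hx
  have hZx : ∑ i, ‖(Z *ᵥ x) i‖ ^ 2 < ∑ j, ‖x j‖ ^ 2 := hZ x hx
  have ho : IsOpen {z : Matrix (Fin m) (Fin n) ℂ × (Fin n → ℂ) |
      ∑ i, ‖(z.1 *ᵥ z.2) i‖ ^ 2 < ∑ j, ‖z.2 j‖ ^ 2} := ?_
  · exact ho.mem_nhds hZx
  apply isOpen_lt
  · refine continuous_finsetSum _ fun i _ => ((Continuous.norm ?_).pow 2)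
    exact (continuous_apply i).comp (Continuous.matrix_mulVec continuous_fst continuous_snd)
  · fun_prop

theorem isBounded_typeIDomain (m n : ℕ) : Bornology.IsBounded (typeIDomain m n) := by
  refine (Metric.isBounded_closedBall (x := (0 : Matrix (Fin m) (Fin n) ℂ)) (r := 1)).subset ?_
  intro Z hZ
  rw [mem_closedBall_zero_iff, Matrix.norm_le_iff zero_le_one]
  intro i j
  have h := (mem_typeIDomain_iff Z).mp hZ (Pi.single j 1) (by simp)
  have e : ∑ k, ‖(Pi.single j 1 : Fin n → ℂ) k‖ ^ 2 = 1 := by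
    rw [Finset.sum_eq_single j] <;> simp +contextual
  rw [e] at h
  simp only [Matrix.mulVec_single_one, Matrix.col_apply] at h
  have h2 := Finset.single_le_sum (f := fun i => ‖Z i j‖ ^ 2) (fun i _ => by positivity)
    (Finset.mem_univ i)
  have h3 : ‖Z i j‖ ^ 2 < 1 := lt_of_le_of_lt h2 h
  nlinarith [norm_nonneg (Z i j)]

/-- Non-existence in the equal-rank case: if `2 ≤ q ≤ p' < p`, then there is no proper
holomorphic map from `D^I_{p,q}` to `D^I_{p',q}`. -/
theorem stmt_4 (p q p' : ℕ) (h2q : 2 ≤ q) (hqp' : q ≤ p') (hp'p : p' < p) :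
    ¬ ∃ f : Matrix (Fin p) (Fin q) ℂ → Matrix (Fin p') (Fin q) ℂ,
        DifferentiableOn ℂ f (typeIDomain p q) ∧
        ProperOn f (typeIDomain p q) (typeIDomain p' q) := by
  rintro ⟨f, hf, hp⟩
  refine no_proper ?_ f _ _ (isOpen_typeIDomain p q) (isBounded_typeIDomain p q) ⟨0, ?_⟩
    (isOpen_typeIDomain p' q) hf hp
  · simp only [Module.finrank_matrix, Fintype.card_fin, Module.finrank_self, mul_one]
    exact Nat.mul_lt_mul_of_pos_right hp'p (by omega)
  · simpa [typeIDomain] using Matrix.PosDef.one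
end
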